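/- arXiv:2207.03238 — 4 statements merged into one kernel-verified Lean document; each statement's English description precedes it below -/
import Mathlib

section
/- Let (X,d) be a compact metric space and f: X → X a continuous map satisfying the specification property, let φ: X → ℝ be continuous and α ∈ ℝ with K_α ≠ ∅, and assume mdim_M(X,f,d) < ∞. Then Λ_φ mdim_M(f, α, d) ≤ H_φ mdim_M(f, α, d). -/
open Filter Set MeasureTheory
open scoped ENNReal NNReal Topology

noncomputable section

variable {Y : Type*}

/-- The dynamical (Bowen) distance `d_n` associated to a distance function `d`. -/
def dynDist (d : Y → Y → ℝ) (f : Y → Y) (n : ℕ) (x y : Y) : ℝ :=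
  ⨆ j : Fin n, d (f^[(j : ℕ)] x) (f^[(j : ℕ)] y)

/-- The `(n,ε)`-dynamical ball around `x`. -/
def dynBall (d : Y → Y → ℝ) (f : Y → Y) (n : ℕ) (ε : ℝ) (x : Y) : Set Y :=
  {y | dynDist d f n x y < ε}

/-- A set `E` is `(n,ε)`-separated if distinct points of `E` are at `d_n`-distance `> ε`. -/
def IsDynSep (d : Y → Y → ℝ) (f : Y → Y) (n : ℕ) (ε : ℝ) (E : Set Y) : Prop :=
  E.Pairwise fun x y => ε < dynDist d f n x y

/-- Maximal cardinality of an `(n,ε)`-separated subset of `P`. -/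
def sepMaxCard (d : Y → Y → ℝ) (f : Y → Y) (n : ℕ) (ε : ℝ) (P : Set Y) : ℕ :=
  sSup {m | ∃ E : Finset Y, ↑E ⊆ P ∧ IsDynSep d f n ε ↑E ∧ E.card = m}

/-- `h(f,ε) = limsup_n (1/n) log s(f,n,ε)` (computed inside `P`). -/
def hSep (d : Y → Y → ℝ) (f : Y → Y) (P : Set Y) (ε : ℝ) : EReal :=
  Filter.limsup (fun n : ℕ => ((Real.log (sepMaxCard d f n ε P) / n : ℝ) : EReal)) Filter.atTop

/-- Upper metric mean dimension (separated-sets version). -/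
def mdimSep (d : Y → Y → ℝ) (f : Y → Y) (P : Set Y) : EReal :=
  Filter.limsup (fun ε : ℝ => hSep d f P ε * (((|Real.log ε|)⁻¹ : ℝ) : EReal))
    (nhdsWithin (0 : ℝ) (Set.Ioi 0))

/-- The Carathéodory sum `m(Z,s,N,ε)`: infimum over countable covers of `Z` by dynamical
balls of lengths `≥ N` of `Σ exp(−s·n_i)`. -/
def mCover (d : Y → Y → ℝ) (f : Y → Y) (Z : Set Y) (s : ℝ) (N : ℕ) (ε : ℝ) : ℝ≥0∞ :=
  ⨅ (Γ : Set (Y × ℕ)) (_ : Γ.Countable) (_ : ∀ q ∈ Γ, N ≤ q.2)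
    (_ : Z ⊆ ⋃ q ∈ Γ, dynBall d f q.2 ε q.1),
      ∑' q : Γ, ENNReal.ofReal (Real.exp (-(s * ((q : Y × ℕ).2 : ℝ))))

/-- `m(Z,s,ε) = lim_{N→∞} m(Z,s,N,ε)` (a monotone limit, hence a supremum). -/
def mCarat (d : Y → Y → ℝ) (f : Y → Y) (Z : Set Y) (s : ℝ) (ε : ℝ) : ℝ≥0∞ :=
  ⨆ N : ℕ, mCover d f Z s N ε

/-- `h(Z,f,ε) = inf {s : m(Z,s,ε) = 0}`. -/
def hCov (d : Y → Y → ℝ) (f : Y → Y) (Z : Set Y) (ε : ℝ) : ℝ :=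
  sInf {s : ℝ | mCarat d f Z s ε = 0}

/-- Upper metric mean dimension of `f` on the (possibly non-compact) subset `Z`. -/
def mdimC (d : Y → Y → ℝ) (f : Y → Y) (Z : Set Y) : EReal :=
  Filter.limsup (fun ε : ℝ => ((hCov d f Z ε * (|Real.log ε|)⁻¹ : ℝ) : EReal))
    (nhdsWithin (0 : ℝ) (Set.Ioi 0))

/-- Birkhoff average `(1/n) Σ_{j<n} φ(f^j x)`. -/
def birkhoff (f : Y → Y) (φ : Y → ℝ) (n : ℕ) (x : Y) : ℝ :=
  (∑ j ∈ Finset.range n, φ (f^[j] x)) / n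

/-- The level set `K_α`. -/
def Kset (f : Y → Y) (φ : Y → ℝ) (α : ℝ) : Set Y :=
  {x | Filter.Tendsto (fun n : ℕ => birkhoff f φ n x) Filter.atTop (nhds α)}

/-- The set `P(α,δ,n)`. -/
def Pset (f : Y → Y) (φ : Y → ℝ) (α δ : ℝ) (n : ℕ) : Set Y :=
  {x | |birkhoff f φ n x - α| < δ}

/-- Minimal number of `(n,ε)`-dynamical balls needed to cover `P`. -/
def coverMinCard (d : Y → Y → ℝ) (f : Y → Y) (n : ℕ) (ε : ℝ) (P : Set Y) : ℕ :=
  sInf {m | ∃ F : Finset Y, F.card = m ∧ P ⊆ ⋃ x ∈ F, dynBall d f n ε x}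

/-- `Λ_φ(α,ε) = lim_{δ→0} liminf_n (1/n) log N(α,δ,n,ε)` (a monotone limit, hence an
infimum over `δ > 0`). -/
def LambdaEps (d : Y → Y → ℝ) (f : Y → Y) (φ : Y → ℝ) (α ε : ℝ) : EReal :=
  ⨅ (δ : ℝ) (_ : 0 < δ),
    Filter.liminf (fun n : ℕ =>
      ((Real.log (coverMinCard d f n ε (Pset f φ α δ n)) / n : ℝ) : EReal)) Filter.atTop

/-- `Λ_φ mdim_M(f,α,d) = limsup_{ε→0} Λ_φ(α,ε)/|log ε|`. -/
def LambdaMdim (d : Y → Y → ℝ) (f : Y → Y) (φ : Y → ℝ) (α : ℝ) : EReal :=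
  Filter.limsup (fun ε : ℝ => LambdaEps d f φ α ε * (((|Real.log ε|)⁻¹ : ℝ) : EReal))
    (nhdsWithin (0 : ℝ) (Set.Ioi 0))

/-- A finite Borel partition of `X`. -/
structure FinBorelPartition (X : Type*) [MeasurableSpace X] where
  parts : Finset (Set X)
  meas : ∀ s ∈ parts, MeasurableSet s
  cover : ∀ x : X, ∃ s ∈ parts, x ∈ s
  disj : ∀ s ∈ parts, ∀ t ∈ parts, s ≠ t → Disjoint s t

/-- The dynamical refinement `ξ^n = ⋁_{j=0}^{n−1} f^{−j} ξ` of a finite family of sets. -/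
def dynRefine {X : Type*} (f : X → X) (P : Finset (Set X)) (n : ℕ) : Finset (Set X) :=
  letI := Classical.decEq (Set X)
  ((Finset.range n).pi fun _ => P).image fun c =>
    ⋂ (j : ℕ) (h : j ∈ Finset.range n), f^[j] ⁻¹' c j h

/-- Entropy `H_μ(P) = Σ_C −μ(C) log μ(C)` of a finite family of sets. -/
def partEntropy {X : Type*} [MeasurableSpace X] (μ : Measure X) (P : Finset (Set X)) : ℝ :=
  ∑ s ∈ P, Real.negMulLog (μ s).toReal

/-- `h_μ(f,ξ) = lim_n (1/n) H_μ(ξ^n)`. -/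
def dynEntropy {X : Type*} [MeasurableSpace X] (f : X → X) (μ : Measure X)
    (ξ : FinBorelPartition X) : ℝ :=
  Filter.limsup (fun n : ℕ => partEntropy μ (dynRefine f ξ.parts n) / n) Filter.atTop

/-- `H_φ mdim_M(f,α,d)`. -/
def HphiMdim {X : Type*} [MetricSpace X] [MeasurableSpace X] (f : X → X) (φ : X → ℝ)
    (α : ℝ) : EReal :=
  Filter.limsup (fun ε : ℝ =>
    (⨆ (μ : ProbabilityMeasure X)
        (_ : Measure.map f (μ : Measure X) = (μ : Measure X) ∧
             ∫ x, φ x ∂(μ : Measure X) = α),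
      ⨅ (ξ : FinBorelPartition X) (_ : ∀ s ∈ ξ.parts, Metric.diam s < ε),
        ((dynEntropy f (μ : Measure X) ξ : ℝ) : EReal)) * (((|Real.log ε|)⁻¹ : ℝ) : EReal))
    (nhdsWithin (0 : ℝ) (Set.Ioi 0))

/-- The specification property. -/
def SpecificationProperty {X : Type*} [MetricSpace X] (f : X → X) : Prop :=
  ∀ ε : ℝ, 0 < ε → ∃ m : ℕ, ∀ (k : ℕ) (a b : Fin k → ℕ) (x : Fin k → X),
    (∀ j, a j ≤ b j) →
    (∀ (j : ℕ) (h : j + 1 < k), b ⟨j, Nat.lt_of_succ_lt h⟩ + m ≤ a ⟨j + 1, h⟩) →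
    ∃ y : X, ∀ (j : Fin k) (p : ℕ), p ≤ b j - a j →
      dist (f^[p + a j] y) (f^[p] (x j)) < ε


/-- The distance function of a metric space, as a plain function. -/
def mDist (X : Type*) [MetricSpace X] : X → X → ℝ := fun x y => dist x y

end

section Coding

variable {X : Type*} [MetricSpace X] {f : X → X} {ε : ℝ}

/-- Any two distinct points of the finite set `E` are at `d_n`-distance at least `ε`. -/
def WeakDynSep (f : X → X) (ε : ℝ) (n : ℕ) (E : Finset X) : Prop :=
  ∀ x ∈ E, ∀ y ∈ E, x ≠ y → ∃ j < n, ε ≤ dist (f^[j] x) (f^[j] y)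

/-- `G` satisfies the Kraft inequality on every finite set that is separated up to time `n`. -/
def KraftCost (f : X → X) (ε : ℝ) (n : ℕ) (G : X → ℝ) : Prop :=
  ∀ E : Finset X, WeakDynSep f ε n E → ∑ x ∈ E, Real.exp (-G x) ≤ 1

lemma kraftCost_zero : KraftCost f ε 0 fun _ => 0 := by
  intro E hE
  have h : E.card ≤ 1 := Finset.card_le_one.2 fun x hx y hy => by
    by_contra hxy
    obtain ⟨j, hj, -⟩ := hE x hx y hy hxy
    omega
  simpa using h

/-- Prepending to a cost `G` the cost of a label that determines an orbit up to scale `ε`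
during `q` steps. -/
lemma KraftCost.prepend {W : Type*} (hε : 0 < ε) {n q : ℕ} {G : X → ℝ}
    (hG : KraftCost f ε n G) (S : Finset W) (l : X → W) (hl : ∀ x, l x ∈ S)
    (hsep : ∀ x y, l x = l y → ∀ j < q, dist (f^[j] x) (f^[j] y) < ε)
    (Q : W → ℝ) (hQ : ∀ w ∈ S, 0 ≤ Q w) (hsum : ∑ w ∈ S, Q w ≤ 1) (g : X → ℝ)
    (hg : ∀ x, Real.exp (-g x) ≤ Q (l x)) :
    KraftCost f ε (q + n) fun x => g x + G (f^[q] x) := by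
  classical
  intro E hE
  have hfib : ∀ w ∈ S, ∑ x ∈ E with l x = w, Real.exp (-G (f^[q] x)) ≤ 1 := by
    intro w _
    have key : ∀ x ∈ E.filter (l · = w), ∀ y ∈ E.filter (l · = w), x ≠ y →
        ∃ j < n, ε ≤ dist (f^[j] (f^[q] x)) (f^[j] (f^[q] y)) := by
      intro x hx y hy hxy
      simp only [Finset.mem_filter] at hx hy
      obtain ⟨j, hj, hd⟩ := hE x hx.1 y hy.1 hxy
      have hqj : q ≤ j := by
        by_contra! h
        exact absurd (hsep x y (hx.2.trans hy.2.symm) j h) (not_lt.2 hd)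
      refine ⟨j - q, by omega, ?_⟩
      rwa [← Function.iterate_add_apply, ← Function.iterate_add_apply, Nat.sub_add_cancel hqj]
    have hinj : Set.InjOn f^[q] (E.filter (l · = w)) := by
      intro x hx y hy hxy
      by_contra hne
      obtain ⟨j, _, hd⟩ := key x hx y hy hne
      rw [hxy, dist_self] at hd
      linarith
    rw [← Finset.sum_image (f := fun y => Real.exp (-G y)) hinj]
    apply hG
    intro x hx y hy hxy
    obtain ⟨x', hx', rfl⟩ := Finset.mem_image.1 hx
    obtain ⟨y', hy', rfl⟩ := Finset.mem_image.1 hy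
    exact key x' hx' y' hy' fun h => hxy (h ▸ rfl)
  calc ∑ x ∈ E, Real.exp (-(g x + G (f^[q] x)))
      ≤ ∑ x ∈ E, Q (l x) * Real.exp (-G (f^[q] x)) := by
        refine Finset.sum_le_sum fun x _ => ?_
        rw [neg_add, Real.exp_add]
        exact mul_le_mul_of_nonneg_right (hg x) (Real.exp_pos _).le
    _ = ∑ w ∈ S, ∑ x ∈ E with l x = w, Q (l x) * Real.exp (-G (f^[q] x)) :=
        (Finset.sum_fiberwise_of_maps_to (fun x _ => hl x) _).symm
    _ = ∑ w ∈ S, Q w * ∑ x ∈ E with l x = w, Real.exp (-G (f^[q] x)) := by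
        refine Finset.sum_congr rfl fun w _ => ?_
        rw [Finset.mul_sum]
        refine Finset.sum_congr rfl fun x hx => ?_
        rw [(Finset.mem_filter.1 hx).2]
    _ ≤ ∑ w ∈ S, Q w * 1 :=
        Finset.sum_le_sum fun w hw => mul_le_mul_of_nonneg_left (hfib w hw) (hQ w hw)
    _ ≤ 1 := by simpa using hsum

/-- A one-step label with values in the finite set `S` may be prepended `s` times at the
cost of `log S.card` each. -/
lemma KraftCost.prepend_uniform {W : Type*} (hε : 0 < ε) {n : ℕ} {G : X → ℝ}
    (hG : KraftCost f ε n G) (S : Finset W) (l : X → W) (hl : ∀ x, l x ∈ S)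
    (hsep : ∀ x y, l x = l y → dist x y < ε) (s : ℕ) :
    KraftCost f ε (s + n) fun x => s * Real.log S.card + G (f^[s] x) := by
  induction s with
  | zero => simpa using hG
  | succ s ih =>
    have h := ih.prepend hε (q := 1) S l hl (fun x y hxy j hj => by
        obtain rfl : j = 0 := by omega
        exact hsep x y hxy) (fun _ => (S.card : ℝ)⁻¹) (fun _ _ => by positivity)
      (by
        rw [Finset.sum_const, nsmul_eq_mul]
        exact mul_inv_le_one) (fun _ => Real.log S.card)
      (fun x => by
        have : 0 < S.card := Finset.card_pos.2 ⟨_, hl x⟩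
        rw [Real.exp_neg, Real.exp_log (by exact_mod_cast this)])
    rw [show s + 1 + n = 1 + (s + n) by ring]
    convert h using 2 with x
    rw [Function.iterate_succ_apply]
    push_cast
    simp only [Function.iterate_one]
    ring

/-- A `q`-step label may be prepended `t` times. -/
lemma KraftCost.prepend_blocks {W : Type*} (hε : 0 < ε) {n q : ℕ} {G : X → ℝ}
    (hG : KraftCost f ε n G) (S : Finset W) (l : X → W) (hl : ∀ x, l x ∈ S)
    (hsep : ∀ x y, l x = l y → ∀ j < q, dist (f^[j] x) (f^[j] y) < ε)
    (Q : W → ℝ) (hQ : ∀ w ∈ S, 0 ≤ Q w) (hsum : ∑ w ∈ S, Q w ≤ 1) (g : X → ℝ)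
    (hg : ∀ x, Real.exp (-g x) ≤ Q (l x)) (t : ℕ) :
    KraftCost f ε (t * q + n) fun x =>
      ∑ i ∈ Finset.range t, g (f^[i * q] x) + G (f^[t * q] x) := by
  induction t with
  | zero => simpa using hG
  | succ t ih =>
    have h := ih.prepend hε S l hl hsep Q hQ hsum g hg
    rw [show (t + 1) * q + n = q + (t * q + n) by ring]
    convert h using 2 with x
    rw [Finset.sum_range_succ', show (t + 1) * q = t * q + q by ring,
      Function.iterate_add_apply]
    have : ∀ i, f^[(i + 1) * q] x = f^[i * q] (f^[q] x) := fun i => by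
      rw [← Function.iterate_add_apply, add_mul, one_mul]
    simp only [this, zero_mul, Function.iterate_zero, id_eq]
    ring

/-- Jensen's inequality: the average cost on a separated set is at least the logarithm of
its cardinality. -/
lemma KraftCost.card_mul_log_le {n : ℕ} {G : X → ℝ} (hG : KraftCost f ε n G)
    {E : Finset X} (hE : WeakDynSep f ε n E) :
    E.card * Real.log E.card ≤ ∑ x ∈ E, G x := by
  rcases E.eq_empty_or_nonempty with rfl | hne
  · simp
  have hpos : (0 : ℝ) < E.card := by exact_mod_cast Finset.card_pos.2 hne
  have h1 : ∑ x ∈ E, (-G x + Real.log E.card + 1) ≤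
      ∑ x ∈ E, Real.exp (-G x) * E.card := by
    refine Finset.sum_le_sum fun x _ => ?_
    rw [← Real.exp_log hpos, ← Real.exp_add, Real.exp_log hpos]
    exact Real.add_one_le_exp _
  rw [← Finset.sum_mul] at h1
  have h2 := mul_le_mul_of_nonneg_right (hG E hE) hpos.le
  simp only [Finset.sum_add_distrib, Finset.sum_neg_distrib, Finset.sum_const,
    nsmul_eq_mul] at h1
  linarith

lemma sum_range_sum_range_blocks (a : ℕ → ℝ) (q t : ℕ) :
    ∑ r ∈ Finset.range q, ∑ i ∈ Finset.range t, a (i * q + r) =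
      ∑ j ∈ Finset.range (t * q), a j := by
  rw [Finset.sum_comm]
  induction t with
  | zero => simp
  | succ t ih => rw [Finset.sum_range_succ, ih, add_mul, one_mul, Finset.sum_range_add]

/-- Averaging the block coding over the `q` possible starting times. -/
lemma WeakDynSep.card_mul_log_le {W V : Type*} (hε : 0 < ε) {n q : ℕ} (hqn : q ≤ n)
    {E : Finset X} (hE : WeakDynSep f ε n E)
    (T : Finset V) (k : X → V) (hk : ∀ x, k x ∈ T) (hksep : ∀ x y, k x = k y → dist x y < ε)
    (S : Finset W) (l : X → W) (hl : ∀ x, l x ∈ S)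
    (hsep : ∀ x y, l x = l y → ∀ j < q, dist (f^[j] x) (f^[j] y) < ε)
    (Q : W → ℝ) (hQ : ∀ w ∈ S, 0 ≤ Q w) (hsum : ∑ w ∈ S, Q w ≤ 1) (g : X → ℝ)
    (hg : ∀ x, Real.exp (-g x) ≤ Q (l x)) (hg0 : ∀ x, 0 ≤ g x) :
    q * (E.card * Real.log E.card) ≤
      ∑ x ∈ E, ∑ j ∈ Finset.range n, g (f^[j] x) +
        q * (E.card * (2 * q * Real.log T.card)) := by
  rcases Nat.eq_zero_or_pos q with rfl | hq
  · simp only [Nat.cast_zero, zero_mul, add_zero]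
    exact Finset.sum_nonneg fun x _ => Finset.sum_nonneg fun j _ => hg0 _
  set t := n / q - 1 with ht
  have hdiv : 1 ≤ n / q := (Nat.one_le_div_iff hq).2 hqn
  have htq : t * q + q = (n / q) * q := by
    rw [ht, Nat.sub_mul, one_mul]
    exact Nat.sub_add_cancel (by simpa using Nat.mul_le_mul_right q hdiv)
  have hle : (n / q) * q ≤ n := Nat.div_mul_le_self n q
  have hlt : n < (n / q) * q + q := by
    have := Nat.lt_mul_div_succ n hq
    linarith
  have hlog : 0 ≤ Real.log T.card := Real.log_natCast_nonneg _
  have hr : ∀ r ∈ Finset.range q, (E.card * Real.log E.card : ℝ) ≤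
      ∑ x ∈ E, ∑ i ∈ Finset.range t, g (f^[i * q + r] x) +
        E.card * (2 * q * Real.log T.card) := by
    intro r hr
    rw [Finset.mem_range] at hr
    have h0 := (kraftCost_zero (f := f) (ε := ε)).prepend_uniform hε T k hk hksep (n - r - t * q)
    have h1 := h0.prepend_blocks hε S l hl hsep Q hQ hsum g hg t
    have h2 := h1.prepend_uniform hε T k hk hksep r
    rw [show r + (t * q + (n - r - t * q + 0)) = n by omega] at h2
    refine (h2.card_mul_log_le hE).trans ?_
    rw [← nsmul_eq_mul E.card (_ : ℝ), ← Finset.sum_const, ← Finset.sum_add_distrib]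
    refine Finset.sum_le_sum fun x _ => ?_
    have h3 : ((r : ℝ) + (n - r - t * q : ℕ)) ≤ 2 * q := by
      exact_mod_cast (show r + (n - r - t * q) ≤ 2 * q by omega)
    have h4 := mul_le_mul_of_nonneg_right h3 hlog
    simp only [Function.iterate_add_apply]
    linarith
  have hs := Finset.sum_le_sum hr
  rw [Finset.sum_const, Finset.card_range, nsmul_eq_mul, Finset.sum_add_distrib,
    Finset.sum_const, Finset.card_range, nsmul_eq_mul, Finset.sum_comm] at hs
  refine hs.trans (add_le_add_left (Finset.sum_le_sum fun x _ => ?_) _)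
  rw [sum_range_sum_range_blocks (fun j => g (f^[j] x))]
  exact Finset.sum_le_sum_of_subset_of_nonneg
    (Finset.range_mono (by omega)) fun j _ _ => hg0 _

end Coding

section ContinuousCost

variable {X : Type*} [MetricSpace X] [CompactSpace X] {f : X → X} {ε : ℝ}

lemma exists_pos_forall_dist_iterate_lt (hf : Continuous f) (q : ℕ) {η : ℝ} (hη : 0 < η) :
    ∃ δ > 0, ∀ x y, dist x y < δ → ∀ j < q, dist (f^[j] x) (f^[j] y) < η := by
  have h : ∀ j < q, ∀ᶠ p : X × X in uniformity X, dist (f^[j] p.1) (f^[j] p.2) < η := fun j _ =>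
    (CompactSpace.uniformContinuous_of_continuous (hf.iterate j)).eventually
      (Metric.dist_mem_uniformity hη)
  have h' := (Filter.eventually_all_finite (Set.finite_lt_nat q)).2 h
  obtain ⟨δ, hδ, H⟩ := Metric.mem_uniformity_dist.1 h'
  exact ⟨δ, hδ, fun x y hxy j hj => H hxy j hj⟩

/-- A finite cover by sets of small dynamical diameter, weighted by `Q`, has a continuous cost
function which is at most `-log Q C` on each member `C`, and which nevertheless
pays for a choice of label determining orbits up to scale `ε`. -/
lemma exists_continuous_cost (hf : Continuous f) {q : ℕ} {ε' : ℝ} (hε : ε' < ε)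
    (S : Finset (Set X)) (hSne : S.Nonempty) (hS : ∀ C ∈ S, C.Nonempty)
    (hcov : ∀ x, ∃ C ∈ S, x ∈ C)
    (hdiam : ∀ C ∈ S, ∀ x ∈ C, ∀ y ∈ C, ∀ j < q, dist (f^[j] x) (f^[j] y) ≤ ε')
    (Q : Set X → ℝ) (hQ0 : ∀ C ∈ S, 0 < Q C) (hQ1 : ∀ C ∈ S, Q C ≤ 1) :
    ∃ (g : X → ℝ) (l : X → Set X), Continuous g ∧ (∀ x, 0 ≤ g x) ∧ (∀ x, l x ∈ S) ∧
      (∀ x y, l x = l y → ∀ j < q, dist (f^[j] x) (f^[j] y) < ε) ∧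
      (∀ x, Real.exp (-g x) ≤ Q (l x)) ∧ ∀ C ∈ S, ∀ x ∈ C, g x ≤ -Real.log (Q C) := by
  obtain ⟨δ, hδ, hunif⟩ := exists_pos_forall_dist_iterate_lt hf q (half_pos (sub_pos.2 hε))
  have hlog : ∀ C ∈ S, 0 ≤ -Real.log (Q C) := fun C hC =>
    neg_nonneg.2 (Real.log_nonpos (hQ0 C hC).le (hQ1 C hC))
  set M := ∑ C ∈ S, -Real.log (Q C) with hM
  have hM0 : 0 ≤ M := Finset.sum_nonneg hlog
  have hMC : ∀ C ∈ S, -Real.log (Q C) ≤ M := fun C hC =>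
    Finset.single_le_sum (f := fun C => -Real.log (Q C)) hlog hC
  have hpen : ∀ (x : X) (C : Set X), 0 ≤ M / δ * Metric.infDist x C := fun x C =>
    mul_nonneg (div_nonneg hM0 hδ.le) Metric.infDist_nonneg
  set g : X → ℝ := fun x =>
    S.inf' hSne fun C => -Real.log (Q C) + M / δ * Metric.infDist x C with hg
  have hlabel : ∀ x, ∃ C ∈ S, Metric.infDist x C < δ ∧ -Real.log (Q C) ≤ g x := by
    intro x
    obtain ⟨C, hC, hgC⟩ := Finset.exists_mem_eq_inf' hSne
      fun C => -Real.log (Q C) + M / δ * Metric.infDist x C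
    by_cases hd : Metric.infDist x C < δ
    · refine ⟨C, hC, hd, ?_⟩
      have := hpen x C
      simp only [hg, hgC]
      linarith
    · obtain ⟨D, hD, hxD⟩ := hcov x
      refine ⟨D, hD, by rwa [Metric.infDist_zero_of_mem hxD], ?_⟩
      have h1 : M ≤ M / δ * Metric.infDist x C := by
        calc M = M / δ * δ := by field_simp
          _ ≤ _ := mul_le_mul_of_nonneg_left (not_lt.1 hd) (div_nonneg hM0 hδ.le)
      have h2 := hlog C hC
      have h3 := hMC D hD
      simp only [hg, hgC]
      linarith
  choose l hlS hld hlg using hlabel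
  refine ⟨g, l, ?_, ?_, hlS, ?_, ?_, ?_⟩
  · exact Continuous.finset_inf'_apply _ fun C _ =>
      continuous_const.add (continuous_const.mul (Metric.continuous_infDist_pt C))
  · intro x
    exact (hlog _ (hlS x)).trans (hlg x)
  · intro x y hxy j hj
    obtain ⟨a, ha, hxa⟩ := (Metric.infDist_lt_iff (hS _ (hlS x))).1 (hld x)
    obtain ⟨b, hb, hyb⟩ := (Metric.infDist_lt_iff (hS _ (hlS y))).1 (hld y)
    rw [← hxy] at hb
    have h1 := hunif x a hxa j hj
    have h2 := hunif y b hyb j hj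
    have h3 := hdiam _ (hlS x) a ha b hb j hj
    have h4 := dist_triangle4 (f^[j] x) (f^[j] a) (f^[j] b) (f^[j] y)
    rw [dist_comm (f^[j] b)] at h4
    linarith
  · intro x
    rw [← Real.le_log_iff_exp_le (hQ0 _ (hlS x))]
    linarith [hlg x]
  · intro C hC x hx
    refine (Finset.inf'_le _ hC).trans ?_
    simp [Metric.infDist_zero_of_mem hx]

end ContinuousCost

section OrbitMeasure

/-- The average of the Dirac masses at the first `n` points of the orbits of the points of `E`. -/
noncomputable def orbitMeasure {X : Type*} [MeasurableSpace X] (f : X → X) (n : ℕ)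
    (E : Finset X) : Measure X :=
  ((n : ℝ≥0∞) * E.card)⁻¹ • ∑ x ∈ E, ∑ j ∈ Finset.range n, Measure.dirac (f^[j] x)

lemma isProbabilityMeasure_orbitMeasure {X : Type*} [MeasurableSpace X] {f : X → X} {n : ℕ}
    (hn : n ≠ 0) {E : Finset X} (hE : E.Nonempty) :
    IsProbabilityMeasure (orbitMeasure f n E) := by
  constructor
  simp only [orbitMeasure, Measure.smul_apply, Measure.finsetSum_apply, measure_univ,
    Finset.sum_const, Finset.card_range, nsmul_eq_mul, smul_eq_mul, mul_one]
  rw [mul_comm (E.card : ℝ≥0∞)]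
  refine ENNReal.inv_mul_cancel ?_ (by finiteness)
  simp [hn, hE.ne_empty]

variable {X : Type*} [MetricSpace X] [CompactSpace X] [MeasurableSpace X] [BorelSpace X]
  {f : X → X}

lemma integral_orbitMeasure (n : ℕ) (E : Finset X) {g : X → ℝ} (hg : Continuous g) :
    ∫ x, g x ∂(orbitMeasure f n E) =
      (∑ x ∈ E, ∑ j ∈ Finset.range n, g (f^[j] x)) / (n * E.card) := by
  have hint : ∀ (ν : Measure X) [IsFiniteMeasure ν], Integrable g ν := fun ν _ =>
    hg.integrable_of_hasCompactSupport (HasCompactSupport.of_compactSpace g)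
  rw [orbitMeasure, integral_smul_measure, integral_finsetSum_measure fun x _ => hint _]
  have : ∀ x ∈ E, ∫ y, g y ∂(∑ j ∈ Finset.range n, Measure.dirac (f^[j] x)) =
      ∑ j ∈ Finset.range n, g (f^[j] x) := fun x _ => by
    rw [integral_finsetSum_measure fun j _ => hint _]
    simp
  rw [Finset.sum_congr rfl this]
  simp [div_eq_inv_mul]

/-- Orbit measures of increasing length accumulate only at invariant measures. -/
lemma map_eq_of_tendsto_orbitMeasure (hf : Continuous f) {n : ℕ → ℕ}
    (hn : Tendsto n atTop atTop) {E : ℕ → Finset X} (hE : ∀ k, (E k).Nonempty)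
    {ν : ℕ → ProbabilityMeasure X} (hν : ∀ k, (ν k : Measure X) = orbitMeasure f (n k) (E k))
    {μ : ProbabilityMeasure X} (hμ : Tendsto ν atTop (𝓝 μ)) :
    Measure.map f (μ : Measure X) = μ := by
  have : IsProbabilityMeasure (Measure.map f (μ : Measure X)) :=
    Measure.isProbabilityMeasure_map hf.aemeasurable
  refine ext_of_forall_integral_eq_of_IsFiniteMeasure fun g => ?_
  rw [integral_map hf.aemeasurable g.continuous.aestronglyMeasurable]
  have h1 := ProbabilityMeasure.tendsto_iff_forall_integral_tendsto.1 hμ g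
  have h2 := ProbabilityMeasure.tendsto_iff_forall_integral_tendsto.1 hμ
    (g.compContinuous ⟨f, hf⟩)
  have h3 := h2.sub h1
  have hb : ∀ k, |∫ x, (g.compContinuous ⟨f, hf⟩) x ∂(ν k : Measure X) -
      ∫ x, g x ∂(ν k : Measure X)| ≤ 2 * ‖g‖ / n k := by
    intro k
    rw [hν k, integral_orbitMeasure _ _ (BoundedContinuousFunction.continuous _),
      integral_orbitMeasure _ _ g.continuous, ← sub_div, ← Finset.sum_sub_distrib]
    have hc : (0 : ℝ) < (E k).card := by exact_mod_cast Finset.card_pos.2 (hE k)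
    have hsum : |∑ x ∈ E k, (∑ j ∈ Finset.range (n k), (g.compContinuous ⟨f, hf⟩) (f^[j] x) -
        ∑ j ∈ Finset.range (n k), g (f^[j] x))| ≤ (E k).card * (2 * ‖g‖) := by
      refine (Finset.abs_sum_le_sum_abs _ _).trans ?_
      rw [← nsmul_eq_mul]
      refine Finset.sum_le_card_nsmul _ _ _ fun x _ => ?_
      have : ∀ j, (g.compContinuous ⟨f, hf⟩) (f^[j] x) = g (f^[j + 1] x) := fun j => by
        rw [Function.iterate_succ_apply']
        rfl
      simp only [this]
      rw [← Finset.sum_sub_distrib, Finset.sum_range_sub (fun j => g (f^[j] x))]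
      have h1 := g.norm_coe_le_norm (f^[n k] x)
      have h2 := g.norm_coe_le_norm (f^[0] x)
      rw [Real.norm_eq_abs] at h1 h2
      exact (abs_sub _ _).trans (by linarith)
    rw [abs_div, abs_of_nonneg (by positivity : (0 : ℝ) ≤ n k * (E k).card)]
    calc _ ≤ (E k).card * (2 * ‖g‖) / (n k * (E k).card) := by gcongr
      _ = 2 * ‖g‖ / n k := by rw [mul_comm (n k : ℝ), mul_div_mul_left _ _ hc.ne']
  have h4 : Tendsto (fun k => 2 * ‖g‖ / (n k : ℝ)) atTop (𝓝 0) :=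
    (tendsto_const_div_atTop_nhds_zero_nat (2 * ‖g‖)).comp hn
  have h5 := squeeze_zero_norm (fun k => (Real.norm_eq_abs _).trans_le (hb k)) h4
  have h6 := tendsto_nhds_unique h3 h5
  exact sub_eq_zero.1 h6

end OrbitMeasure

section Refinement

variable {X : Type*} {f : X → X} {P : Finset (Set X)}

lemma exists_mem_dynRefine (hP : ∀ x, ∃ s ∈ P, x ∈ s) (n : ℕ) (x : X) :
    ∃ C ∈ dynRefine f P n, x ∈ C := by
  classical
  choose p hp hxp using hP
  refine ⟨⋂ (j : ℕ) (_ : j ∈ Finset.range n), f^[j] ⁻¹' p (f^[j] x), ?_, ?_⟩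
  · exact Finset.mem_image.2
      ⟨fun j _ => p (f^[j] x), Finset.mem_pi.2 fun j _ => hp _, rfl⟩
  · exact Set.mem_iInter₂.2 fun j _ => hxp _

lemma exists_of_mem_dynRefine {n : ℕ} {C : Set X} (hC : C ∈ dynRefine f P n) {j : ℕ}
    (hj : j < n) : ∃ s ∈ P, ∀ x ∈ C, f^[j] x ∈ s := by
  classical
  obtain ⟨c, hc, rfl⟩ := Finset.mem_image.1 hC
  exact ⟨c j (Finset.mem_range.2 hj), Finset.mem_pi.1 hc _ _,
    fun x hx => Set.mem_iInter₂.1 hx j (Finset.mem_range.2 hj)⟩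

lemma disjoint_of_mem_dynRefine (hP : ∀ s ∈ P, ∀ t ∈ P, s ≠ t → Disjoint s t) {n : ℕ}
    {C D : Set X} (hC : C ∈ dynRefine f P n) (hD : D ∈ dynRefine f P n) (hCD : C ≠ D) :
    Disjoint C D := by
  classical
  obtain ⟨c, hc, rfl⟩ := Finset.mem_image.1 hC
  obtain ⟨d, hd, rfl⟩ := Finset.mem_image.1 hD
  have : ∃ j h, c j h ≠ d j h := by
    by_contra! h
    exact hCD (by simp only [h])
  obtain ⟨j, h, hne⟩ := this
  refine Disjoint.mono (Set.iInter₂_subset j h) (Set.iInter₂_subset j h) ?_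
  exact (hP _ (Finset.mem_pi.1 hc j h) _ (Finset.mem_pi.1 hd j h) hne).preimage _

lemma measurableSet_of_mem_dynRefine [MeasurableSpace X] (hf : Measurable f)
    (hP : ∀ s ∈ P, MeasurableSet s) {n : ℕ} {C : Set X} (hC : C ∈ dynRefine f P n) :
    MeasurableSet C := by
  classical
  obtain ⟨c, hc, rfl⟩ := Finset.mem_image.1 hC
  exact MeasurableSet.iInter fun j => MeasurableSet.iInter fun hj =>
    (hf.iterate j) (hP _ (Finset.mem_pi.1 hc j hj))

lemma card_dynRefine_le (n : ℕ) : (dynRefine f P n).card ≤ P.card ^ n := by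
  classical
  refine Finset.card_image_le.trans ?_
  simp [Finset.card_pi]

lemma sum_measureReal_le_one [MeasurableSpace X] (μ : Measure X) [IsProbabilityMeasure μ]
    {S : Finset (Set X)} (hm : ∀ C ∈ S, MeasurableSet C)
    (hd : ∀ C ∈ S, ∀ D ∈ S, C ≠ D → Disjoint C D) : ∑ C ∈ S, μ.real C ≤ 1 := by
  rw [← measureReal_biUnion_finset (f := fun C : Set X => C)
    (fun C hC D hD h => hd C hC D hD h) hm]
  exact measureReal_le_one

lemma partEntropy_le [MeasurableSpace X] (μ : Measure X) [IsProbabilityMeasure μ]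
    {S : Finset (Set X)} (hm : ∀ C ∈ S, MeasurableSet C)
    (hd : ∀ C ∈ S, ∀ D ∈ S, C ≠ D → Disjoint C D) :
    partEntropy μ S ≤ Real.log S.card + 1 := by
  rcases S.eq_empty_or_nonempty with rfl | hne
  · simp [partEntropy]
  have hpos : (0 : ℝ) < S.card := by exact_mod_cast Finset.card_pos.2 hne
  have key : ∀ C ∈ S, Real.negMulLog (μ.real C) ≤
      μ.real C * Real.log S.card + (S.card : ℝ)⁻¹ := by
    intro C _
    rcases (measureReal_nonneg (μ := μ) (s := C)).eq_or_lt with h | h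
    · rw [← h]
      simp
    · have h1 := Real.one_sub_inv_le_log_of_pos (mul_pos h hpos)
      rw [Real.log_mul h.ne' hpos.ne'] at h1
      have h2 := mul_le_mul_of_nonneg_left h1 h.le
      have h3 : μ.real C * (1 - (μ.real C * S.card)⁻¹) = μ.real C - (S.card : ℝ)⁻¹ := by
        field_simp
      rw [Real.negMulLog]
      linarith
  have hlog : 0 ≤ Real.log S.card := Real.log_natCast_nonneg _
  calc partEntropy μ S ≤ ∑ C ∈ S, (μ.real C * Real.log S.card + (S.card : ℝ)⁻¹) :=
        Finset.sum_le_sum key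
    _ = (∑ C ∈ S, μ.real C) * Real.log S.card + 1 := by
        rw [Finset.sum_add_distrib, ← Finset.sum_mul, Finset.sum_const, nsmul_eq_mul,
          mul_inv_cancel₀ hpos.ne']
    _ ≤ _ := by
        have := mul_le_mul_of_nonneg_right (sum_measureReal_le_one μ hm hd) hlog
        linarith

lemma le_dynEntropy [MeasurableSpace X] (hf : Measurable f) (μ : Measure X)
    [IsProbabilityMeasure μ] (ξ : FinBorelPartition X) {c : ℝ}
    (h : ∀ q : ℕ, q * c ≤ partEntropy μ (dynRefine f ξ.parts q)) : c ≤ dynEntropy f μ ξ := by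
  refine le_limsup_of_frequently_le (Eventually.frequently ?_) ?_
  · filter_upwards [eventually_gt_atTop 0] with q hq
    rw [le_div_iff₀ (by exact_mod_cast hq), mul_comm]
    exact h q
  · refine ⟨Real.log ξ.parts.card + 1, ?_⟩
    rw [eventually_map]
    filter_upwards [eventually_gt_atTop 0] with q hq
    have hq1 : (1 : ℝ) ≤ q := by exact_mod_cast hq
    rw [div_le_iff₀ (by linarith)]
    have h1 := partEntropy_le μ (S := dynRefine f ξ.parts q)
      (fun C hC => measurableSet_of_mem_dynRefine hf ξ.meas hC)
      (fun C hC D hD => disjoint_of_mem_dynRefine ξ.disj hC hD)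
    have h2 : Real.log (dynRefine f ξ.parts q).card ≤ q * Real.log ξ.parts.card := by
      rw [← Real.log_pow]
      rcases Nat.eq_zero_or_pos (dynRefine f ξ.parts q).card with h0 | h0
      · rw [h0]
        simp only [Nat.cast_zero, Real.log_zero]
        exact_mod_cast Real.log_natCast_nonneg (ξ.parts.card ^ q)
      · exact Real.log_le_log (by exact_mod_cast h0) (by exact_mod_cast card_dynRefine_le q)
    linarith

end Refinement

section EntropyBound

variable {X : Type*} [MetricSpace X] [CompactSpace X] [MeasurableSpace X] [BorelSpace X]
  {f : X → X} {ε : ℝ}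

lemma integral_le_sum_measureReal_mul (μ : Measure X) [IsProbabilityMeasure μ] {g : X → ℝ}
    (hg : Continuous g) {S : Finset (Set X)} (hcov : ∀ x, ∃ C ∈ S, x ∈ C)
    (hm : ∀ C ∈ S, MeasurableSet C) (hd : ∀ C ∈ S, ∀ D ∈ S, C ≠ D → Disjoint C D)
    {b : Set X → ℝ} (hb : ∀ C ∈ S, ∀ x ∈ C, g x ≤ b C) :
    ∫ x, g x ∂μ ≤ ∑ C ∈ S, μ.real C * b C := by
  have hint : Integrable g μ :=
    hg.integrable_of_hasCompactSupport (HasCompactSupport.of_compactSpace g)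
  have huniv : ⋃ C ∈ S, C = Set.univ := by
    ext x
    simpa using hcov x
  rw [← setIntegral_univ, ← huniv, integral_biUnion_finset S hm
    (fun C hC D hD h => hd C hC D hD h) (fun C _ => hint.integrableOn)]
  refine Finset.sum_le_sum fun C hC => ?_
  calc ∫ x in C, g x ∂μ ≤ ∫ _ in C, b C ∂μ :=
        setIntegral_mono_on hint.integrableOn (integrable_const _) (hm C hC) (hb C hC)
    _ = μ.real C * b C := by simp

/-- If separated sets `E k` grow at exponential rate at least `c`, then every accumulation point
of their orbit measures has entropy at least `c` with respect to partitions of diameter less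
than the separation scale. -/
lemma mul_le_partEntropy_of_tendsto_orbitMeasure [Nonempty X] (hf : Continuous f) (hε : 0 < ε)
    {c : ℝ} {n : ℕ → ℕ} (hn : Tendsto n atTop atTop) {E : ℕ → Finset X}
    (hE : ∀ k, (E k).Nonempty) (hsep : ∀ k, WeakDynSep f ε (n k) (E k))
    (hc : ∀ k, c * n k ≤ Real.log (E k).card)
    {ν : ℕ → ProbabilityMeasure X} (hν : ∀ k, (ν k : Measure X) = orbitMeasure f (n k) (E k))
    {μ : ProbabilityMeasure X} (hμ : Tendsto ν atTop (𝓝 μ))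
    (ξ : FinBorelPartition X) (hξ : ∀ s ∈ ξ.parts, Metric.diam s < ε) (q : ℕ) :
    q * c ≤ partEntropy (μ : Measure X) (dynRefine f ξ.parts q) := by
  classical
  have hpne : ξ.parts.Nonempty :=
    let ⟨s, hs, _⟩ := ξ.cover (Classical.arbitrary X)
    ⟨s, hs⟩
  obtain ⟨s₀, hs₀, hmax⟩ := Finset.exists_max_image ξ.parts Metric.diam hpne
  have hdist : ∀ s ∈ ξ.parts, ∀ x ∈ s, ∀ y ∈ s, dist x y ≤ Metric.diam s₀ :=
    fun s hs x hx y hy =>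
      (Metric.dist_le_diam_of_mem Metric.isBounded_of_compactSpace hx hy).trans (hmax s hs)
  choose k hk hxk using ξ.cover
  have hksep : ∀ x y, k x = k y → dist x y < ε := fun x y hxy =>
    (hdist _ (hk x) x (hxk x) y (hxy ▸ hxk y)).trans_lt (hξ s₀ hs₀)
  set S := (dynRefine f ξ.parts q).filter Set.Nonempty with hSdef
  have hSsub : ∀ C ∈ S, C ∈ dynRefine f ξ.parts q := fun C hC => (Finset.mem_filter.1 hC).1
  have hcov : ∀ x, ∃ C ∈ S, x ∈ C := fun x =>
    let ⟨C, hC, hx⟩ := exists_mem_dynRefine ξ.cover q x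
    ⟨C, Finset.mem_filter.2 ⟨hC, x, hx⟩, hx⟩
  have hSne : S.Nonempty :=
    let ⟨C, hC, _⟩ := hcov (Classical.arbitrary X)
    ⟨C, hC⟩
  have hm : ∀ C ∈ S, MeasurableSet C := fun C hC =>
    measurableSet_of_mem_dynRefine hf.measurable ξ.meas (hSsub C hC)
  have hd : ∀ C ∈ S, ∀ D ∈ S, C ≠ D → Disjoint C D := fun C hC D hD =>
    disjoint_of_mem_dynRefine ξ.disj (hSsub C hC) (hSsub D hD)
  have hdiam : ∀ C ∈ S, ∀ x ∈ C, ∀ y ∈ C, ∀ j < q,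
      dist (f^[j] x) (f^[j] y) ≤ Metric.diam s₀ := by
    intro C hC x hx y hy j hj
    obtain ⟨s, hs, H⟩ := exists_of_mem_dynRefine (hSsub C hC) hj
    exact hdist s hs _ (H x hx) _ (H y hy)
  have hcard : (1 : ℝ) ≤ S.card := by exact_mod_cast Finset.card_pos.2 hSne
  have hsum1 := sum_measureReal_le_one (μ : Measure X) hm hd
  have hent : partEntropy (μ : Measure X) (dynRefine f ξ.parts q) =
      ∑ C ∈ S, Real.negMulLog ((μ : Measure X).real C) := by
    refine (Finset.sum_filter_of_ne fun C _ hC => ?_).symm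
    rw [Set.nonempty_iff_ne_empty]
    rintro rfl
    simp at hC
  have hs : ∀ s : ℝ, 0 < s → q * c ≤
      partEntropy (μ : Measure X) (dynRefine f ξ.parts q) + Real.log (1 + S.card * s) := by
    intro s hs
    have hden : 0 < 1 + S.card * s := by positivity
    set Q : Set X → ℝ := fun C => ((μ : Measure X).real C + s) / (1 + S.card * s) with hQ
    have hQ0 : ∀ C ∈ S, 0 < Q C := fun C _ => by
      have := measureReal_nonneg (μ := (μ : Measure X)) (s := C)
      positivity
    have hQ1 : ∀ C ∈ S, Q C ≤ 1 := fun C _ => by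
      rw [hQ, div_le_one hden]
      have h1 : (μ : Measure X).real C ≤ 1 := measureReal_le_one
      nlinarith
    have hQsum : ∑ C ∈ S, Q C ≤ 1 := by
      rw [hQ, ← Finset.sum_div, div_le_one hden, Finset.sum_add_distrib, Finset.sum_const,
        nsmul_eq_mul]
      linarith
    obtain ⟨g, l, hgc, hg0, hl, hlsep, hgQ, hgC⟩ := exists_continuous_cost hf (hξ s₀ hs₀) S hSne
      (fun C hC => (Finset.mem_filter.1 hC).2) hcov hdiam Q hQ0 hQ1
    have hstep : ∀ᶠ i in atTop, q * c ≤ ∫ x, g x ∂(ν i : Measure X) +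
        q * (2 * q * Real.log ξ.parts.card) / n i := by
      filter_upwards [hn.eventually_ge_atTop q, hn.eventually_gt_atTop 0] with i hqi hni
      have h1 := (hsep i).card_mul_log_le hε hqi ξ.parts k hk hksep S l hl hlsep Q
        (fun C hC => (hQ0 C hC).le) hQsum g hgQ hg0
      have hni' : (0 : ℝ) < n i := by exact_mod_cast hni
      have hEi : (0 : ℝ) < (E i).card := by exact_mod_cast Finset.card_pos.2 (hE i)
      have h2 : (q : ℝ) * ((E i).card * (c * n i)) ≤ q * ((E i).card * Real.log (E i).card) := by
        have := hc i
        gcongr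
      rw [hν i, integral_orbitMeasure _ _ hgc]
      have h3 : (∑ x ∈ E i, ∑ j ∈ Finset.range (n i), g (f^[j] x)) / (n i * (E i).card) +
          q * (2 * q * Real.log ξ.parts.card) / n i =
          (∑ x ∈ E i, ∑ j ∈ Finset.range (n i), g (f^[j] x) +
            q * ((E i).card * (2 * q * Real.log ξ.parts.card))) / (n i * (E i).card) := by
        field_simp
      rw [h3, le_div_iff₀ (by positivity)]
      linarith
    have hlim := (ProbabilityMeasure.tendsto_iff_forall_integral_tendsto.1 hμ
      (BoundedContinuousFunction.mkOfCompact ⟨g, hgc⟩)).add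
      ((tendsto_const_div_atTop_nhds_zero_nat (q * (2 * q * Real.log ξ.parts.card))).comp hn)
    have hle := ge_of_tendsto hlim hstep
    rw [add_zero] at hle
    refine hle.trans ((integral_le_sum_measureReal_mul (μ : Measure X) hgc hcov hm hd hgC).trans ?_)
    rw [hent]
    calc ∑ C ∈ S, (μ : Measure X).real C * -Real.log (Q C)
        ≤ ∑ C ∈ S, (Real.negMulLog ((μ : Measure X).real C) +
            (μ : Measure X).real C * Real.log (1 + S.card * s)) := by
          refine Finset.sum_le_sum fun C _ => ?_
          rcases (measureReal_nonneg (μ := (μ : Measure X)) (s := C)).eq_or_lt with h | h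
          · rw [← h]
            simp
          · rw [hQ, Real.log_div (by positivity) hden.ne', Real.negMulLog]
            have h1 := Real.log_le_log h (by linarith : _ ≤ (μ : Measure X).real C + s)
            nlinarith
      _ ≤ _ := by
          rw [Finset.sum_add_distrib, ← Finset.sum_mul]
          have : 0 ≤ Real.log (1 + S.card * s) :=
            Real.log_nonneg (le_add_of_nonneg_right (by positivity))
          have := mul_le_mul_of_nonneg_right hsum1 this
          linarith
  have hlim : Tendsto (fun s : ℝ => partEntropy (μ : Measure X) (dynRefine f ξ.parts q) +
      Real.log (1 + S.card * s)) (𝓝[>] 0)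
      (𝓝 (partEntropy (μ : Measure X) (dynRefine f ξ.parts q) + Real.log (1 + S.card * 0))) := by
    refine tendsto_nhdsWithin_of_tendsto_nhds (ContinuousAt.tendsto ?_)
    refine continuousAt_const.add (ContinuousAt.log (by fun_prop) (by simp))
  have := ge_of_tendsto hlim (eventually_nhdsWithin_of_forall fun s h => hs s h)
  simpa using this

end EntropyBound

section SeparatedSets

variable {X : Type*} [MetricSpace X] {f : X → X} {ε : ℝ}

lemma dynDist_lt_of_forall_lt (hε : 0 < ε) {n : ℕ} {x y : X}
    (h : ∀ j < n, dist (f^[j] x) (f^[j] y) < ε) : dynDist (mDist X) f n x y < ε := by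
  rcases Nat.eq_zero_or_pos n with rfl | hn
  · simpa [dynDist] using hε
  · have : Nonempty (Fin n) := ⟨⟨0, hn⟩⟩
    obtain ⟨j, hj⟩ := exists_eq_ciSup_of_finite
      (f := fun j : Fin n => mDist X (f^[(j : ℕ)] x) (f^[(j : ℕ)] y))
    rw [dynDist, ← hj]
    exact h j j.2

/-- The cardinality of separated sets of given length is bounded on a compact space. -/
lemma exists_card_le_of_weakDynSep [CompactSpace X] (hf : Continuous f) (hε : 0 < ε) (n : ℕ) :
    ∃ B : ℕ, ∀ E : Finset X, WeakDynSep f ε n E → E.card ≤ B := by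
  obtain ⟨δ, hδ, hunif⟩ := exists_pos_forall_dist_iterate_lt hf n (half_pos hε)
  obtain ⟨t, ht, hcov⟩ := Metric.totallyBounded_iff.1
    (isCompact_univ (X := X)).totallyBounded δ hδ
  have hmem : ∀ x, ∃ y ∈ ht.toFinset, dist x y < δ := fun x => by
    simpa using hcov (Set.mem_univ x)
  choose p hp hxp using hmem
  refine ⟨ht.toFinset.card, fun E hE =>
    Finset.card_le_card_of_injOn p (fun x _ => hp x) fun x hx y hy hxy => ?_⟩
  by_contra hne
  obtain ⟨j, hj, hd⟩ := hE x hx y hy hne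
  have h1 := hunif x (p x) (hxp x) j hj
  have h2 := hunif y (p y) (hxp y) j hj
  rw [hxy] at h1
  have := dist_triangle_right (f^[j] x) (f^[j] y) (f^[j] (p y))
  linarith

/-- A maximal separated subset of `A` is nonempty and spans `A`. -/
lemma exists_weakDynSep_coverMinCard_le [CompactSpace X] (hf : Continuous f) (hε : 0 < ε) (n : ℕ)
    {A : Set X} (hA : A.Nonempty) :
    ∃ E : Finset X, E.Nonempty ∧ ↑E ⊆ A ∧ WeakDynSep f ε n E ∧
      coverMinCard (mDist X) f n ε A ≤ E.card := by
  classical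
  obtain ⟨B, hB⟩ := exists_card_le_of_weakDynSep hf hε n
  obtain ⟨a, ha⟩ := hA
  let p : ℕ → Prop := fun m =>
    ∃ E : Finset X, ↑E ⊆ A ∧ WeakDynSep f ε n E ∧ E.card = m
  have hp0 : p 1 := by
    refine ⟨{a}, by simpa using ha, fun x hx y hy hxy => ?_, by simp⟩
    rw [Finset.mem_singleton] at hx hy
    exact absurd (hx.trans hy.symm) hxy
  have hbound : ∀ m, p m → m ≤ B := by
    rintro m ⟨E, -, hE, rfl⟩
    exact hB E hE
  obtain ⟨E, hEA, hE, hcard⟩ := Nat.findGreatest_spec (hbound 1 hp0) hp0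
  have hmax : ∀ m, p m → m ≤ E.card := fun m hm => by
    rw [hcard]
    exact Nat.le_findGreatest (hbound m hm) hm
  refine ⟨E, Finset.card_pos.1 (hmax 1 hp0), hEA, hE, Nat.sInf_le ⟨E, rfl, fun z hz => ?_⟩⟩
  by_contra hz'
  simp only [Set.mem_iUnion, not_exists] at hz'
  have hfar : ∀ x ∈ E, ∃ j < n, ε ≤ dist (f^[j] x) (f^[j] z) := fun x hx => by
    by_contra! h
    exact hz' x hx (dynDist_lt_of_forall_lt hε h)
  have hzE : z ∉ E := fun h => by
    obtain ⟨j, -, hj⟩ := hfar z h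
    rw [dist_self] at hj
    linarith
  have hins : p (E.card + 1) := by
    refine ⟨insert z E, ?_, ?_, Finset.card_insert_of_notMem hzE⟩
    · rw [Finset.coe_insert]
      exact Set.insert_subset hz hEA
    · intro x hx y hy hxy
      rcases Finset.mem_insert.1 hx with rfl | hx' <;> rcases Finset.mem_insert.1 hy with rfl | hy'
      · exact absurd rfl hxy
      · obtain ⟨j, hj, h⟩ := hfar y hy'
        exact ⟨j, hj, by rwa [dist_comm]⟩
      · exact hfar x hx'
      · exact hE x hx' y hy' hxy
  have := hmax _ hins
  omega

end SeparatedSets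

section Comparison

variable {X : Type*} [MetricSpace X] [CompactSpace X] {f : X → X} {φ : X → ℝ} {α ε : ℝ}

/-- Below the growth rate `LambdaEps` one finds separated sets of points whose Birkhoff averages
are arbitrarily close to `α`. -/
lemma exists_weakDynSep_of_lt_LambdaEps (hf : Continuous f) (hK : (Kset f φ α).Nonempty)
    (hε : 0 < ε) {c : ℝ} (hc : (c : EReal) < LambdaEps (mDist X) f φ α ε) {δ : ℝ} (hδ : 0 < δ)
    (N : ℕ) : ∃ (n : ℕ) (E : Finset X), N < n ∧ E.Nonempty ∧
      (∀ x ∈ E, |birkhoff f φ n x - α| < δ) ∧ WeakDynSep f ε n E ∧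
      c * n ≤ Real.log E.card := by
  have h1 := hc.trans_le (iInf₂_le δ hδ)
  have h2 := eventually_lt_of_lt_liminf h1
  obtain ⟨z, hz⟩ := hK
  have h3 : ∀ᶠ n in atTop, |birkhoff f φ n z - α| < δ := by
    simpa [Real.dist_eq] using Metric.tendsto_nhds.1 hz δ hδ
  obtain ⟨n, hn2, hn3, hn⟩ := (h2.and (h3.and (eventually_gt_atTop N))).exists
  obtain ⟨E, hEne, hEA, hE, hcard⟩ := exists_weakDynSep_coverMinCard_le hf hε n
    (A := Pset f φ α δ n) ⟨z, hn3⟩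
  refine ⟨n, E, hn, hEne, fun x hx => hEA hx, hE, ?_⟩
  have hn0 : (0 : ℝ) < n := by exact_mod_cast (Nat.zero_le N).trans_lt hn
  have h4 := (lt_div_iff₀ hn0).1 (EReal.coe_lt_coe_iff.1 hn2)
  refine h4.le.trans ?_
  rcases Nat.eq_zero_or_pos (coverMinCard (mDist X) f n ε (Pset f φ α δ n)) with h0 | h0
  · rw [h0]
    simpa using Real.log_natCast_nonneg E.card
  · exact Real.log_le_log (by exact_mod_cast h0) (by exact_mod_cast hcard)

variable [MeasurableSpace X] [BorelSpace X]

lemma abs_integral_orbitMeasure_sub_le (hφ : Continuous φ) {n : ℕ} {E : Finset X}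
    (hE : E.Nonempty) {δ : ℝ} (h : ∀ x ∈ E, |birkhoff f φ n x - α| < δ) :
    |∫ x, φ x ∂(orbitMeasure f n E) - α| ≤ δ := by
  have hpos : (0 : ℝ) < E.card := by exact_mod_cast Finset.card_pos.2 hE
  have heq : ∫ x, φ x ∂(orbitMeasure f n E) - α =
      (∑ x ∈ E, (birkhoff f φ n x - α)) / E.card := by
    rw [integral_orbitMeasure _ _ hφ, Finset.sum_sub_distrib, Finset.sum_const, nsmul_eq_mul,
      sub_div, mul_div_cancel_left₀ _ hpos.ne', ← div_div, Finset.sum_div]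
    rfl
  rw [heq, abs_div, abs_of_pos hpos, div_le_iff₀ hpos, mul_comm, ← nsmul_eq_mul]
  exact (Finset.abs_sum_le_sum_abs _ _).trans
    (Finset.sum_le_card_nsmul _ _ _ fun x hx => (h x hx).le)

lemma exists_invariant_measure_le_dynEntropy (hf : Continuous f) (hφ : Continuous φ)
    (hK : (Kset f φ α).Nonempty) (hε : 0 < ε) {c : ℝ}
    (hc : (c : EReal) < LambdaEps (mDist X) f φ α ε) :
    ∃ μ : ProbabilityMeasure X, Measure.map f (μ : Measure X) = μ ∧
      ∫ x, φ x ∂(μ : Measure X) = α ∧ ∀ ξ : FinBorelPartition X,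
        (∀ s ∈ ξ.parts, Metric.diam s < ε) → c ≤ dynEntropy f (μ : Measure X) ξ := by
  have : Nonempty X := hK.to_type
  choose n E hn hEne hEφ hE hcE using fun k : ℕ =>
    exists_weakDynSep_of_lt_LambdaEps hf hK hε hc (Nat.one_div_pos_of_nat (α := ℝ) (n := k)) k
  let ν : ℕ → ProbabilityMeasure X := fun k =>
    ⟨orbitMeasure f (n k) (E k),
      isProbabilityMeasure_orbitMeasure (Nat.ne_zero_of_lt (hn k)) (hEne k)⟩
  obtain ⟨μ, -, σ, hσ, hμ⟩ := (isCompact_univ (X := ProbabilityMeasure X)).tendsto_subseq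
    (x := ν) fun _ => Set.mem_univ _
  have hnσ : Tendsto (n ∘ σ) atTop atTop :=
    (tendsto_atTop_mono (fun k => (hn k).le) tendsto_id).comp hσ.tendsto_atTop
  refine ⟨μ, map_eq_of_tendsto_orbitMeasure hf hnσ (E := E ∘ σ) (fun k => hEne _)
    (ν := ν ∘ σ) (fun k => rfl) hμ, ?_, fun ξ hξ => ?_⟩
  · have h1 := ProbabilityMeasure.tendsto_iff_forall_integral_tendsto.1 hμ
      (BoundedContinuousFunction.mkOfCompact ⟨φ, hφ⟩)
    refine tendsto_nhds_unique h1 ?_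
    rw [tendsto_iff_norm_sub_tendsto_zero]
    exact squeeze_zero (fun _ => norm_nonneg _)
      (fun k => abs_integral_orbitMeasure_sub_le hφ (hEne (σ k)) (hEφ (σ k)))
      (tendsto_one_div_add_atTop_nhds_zero_nat.comp hσ.tendsto_atTop)
  · exact le_dynEntropy hf.measurable _ ξ
      (mul_le_partEntropy_of_tendsto_orbitMeasure hf hε hnσ (E := E ∘ σ) (fun k => hEne _)
        (fun k => hE _) (fun k => hcE _) (ν := ν ∘ σ) (fun k => rfl) hμ ξ hξ)

end Comparison

/-- Proposition 3.8: `Λ_φ mdim_M(f,α,d) ≤ H_φ mdim_M(f,α,d)`. -/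
theorem Lambda_le_Hphi
    {X : Type*} [MetricSpace X] [CompactSpace X] [MeasurableSpace X] [BorelSpace X]
    (f : X → X) (hf : Continuous f) (hspec : SpecificationProperty f)
    (φ : X → ℝ) (hφ : Continuous φ) (α : ℝ) (hK : (Kset f φ α).Nonempty)
    (hfin : mdimSep (mDist X) f Set.univ < ⊤) :
    LambdaMdim (mDist X) f φ α ≤ HphiMdim f φ α := by
  refine limsup_le_limsup ?_
  filter_upwards [self_mem_nhdsWithin] with ε hε
  refine mul_le_mul_of_nonneg_right ?_ (EReal.coe_nonneg.2 (by positivity))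
  refine EReal.ge_of_forall_gt_iff_ge.1 fun c hc => ?_
  obtain ⟨μ, hinv, hint, hent⟩ := exists_invariant_measure_le_dynEntropy hf hφ hK hε hc
  exact le_iSup₂_of_le μ ⟨hinv, hint⟩
    (le_iInf₂ fun ξ hξ => EReal.coe_le_coe_iff.2 (hent ξ hξ))
end

section
/- Let (X,d) be a compact metric space, f: X → X a continuous map with mdim_M(X,f,d) < ∞, φ: X → ℝ continuous, μ an f-invariant Borel probability measure, U a finite open cover of X, and δ > 0. Then there exists a measure ν = Σ_{i=1}^{j} λ_i ν_i, where λ_i > 0, Σ_{i=1}^{j} λ_i = 1 and each ν_i is an ergodic f-invariant Borel probability measure, such that: (b) inf_{ξ ≻ U} h_μ(f,ξ) ≤ inf_{ξ ≻ U} h_ν(f,ξ) + δ/2, and (c) |∫_X φ dν − ∫_X φ dμ| < δ. -/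
open Filter Set MeasureTheory
open scoped ENNReal NNReal Topology

section LabelEntropy

variable {X κ ι : Type*} [MeasurableSpace X]

/-- Shannon entropy of the partition of `X` into the fibres of a labelling `Z : X → κ`. -/
noncomputable def labelEntropy [Fintype κ] (μ : Measure X) (Z : X → κ) : ℝ :=
  ∑ k, Real.negMulLog (μ.real (Z ⁻¹' {k}))

/-- The labels seen along the first `n` points of the orbit of `x`. -/
def itinerary (f : X → X) (c : X → ι) (n : ℕ) (x : X) : Fin n → ι :=
  fun j => c (f^[j] x)

/-- The entropy of `f` with respect to the partition into the fibres of `c`, written as an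
infimum over the time horizon. -/
noncomputable def labelRate [Fintype ι] (f : X → X) (μ : Measure X) (c : X → ι) : ℝ :=
  ⨅ n : ℕ, labelEntropy μ (itinerary f c (n + 1)) / ((n + 1 : ℕ) : ℝ)

theorem negMulLog_add_le {x y : ℝ} (hx : 0 ≤ x) (hy : 0 ≤ y) :
    Real.negMulLog (x + y) ≤ Real.negMulLog x + Real.negMulLog y := by
  rcases hx.eq_or_lt with rfl | hx
  · simp
  rcases hy.eq_or_lt with rfl | hy
  · simp
  have h1 : Real.log x ≤ Real.log (x + y) := Real.log_le_log hx (by linarith)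
  have h2 : Real.log y ≤ Real.log (x + y) := Real.log_le_log hy (by linarith)
  simp only [Real.negMulLog]
  nlinarith

theorem negMulLog_sum_le {s : Finset κ} {p : κ → ℝ} (hp : ∀ k ∈ s, 0 ≤ p k) :
    Real.negMulLog (∑ k ∈ s, p k) ≤ ∑ k ∈ s, Real.negMulLog (p k) := by
  classical
  induction s using Finset.induction_on with
  | empty => simp
  | insert a s ha ih =>
    rw [Finset.sum_insert ha, Finset.sum_insert ha]
    have hs : ∀ k ∈ s, 0 ≤ p k := fun k hk => hp k (Finset.mem_insert_of_mem hk)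
    exact (negMulLog_add_le (hp a (Finset.mem_insert_self a s)) (Finset.sum_nonneg hs)).trans
      (by linarith [ih hs])

theorem negMulLog_le_of_mul {p q r : ℝ} (hp : 0 ≤ p) (hpq : p ≤ q) (hpr : p ≤ r) :
    Real.negMulLog p ≤ -p * Real.log q + -p * Real.log r + (q * r - p) := by
  rcases hp.eq_or_lt with rfl | hp
  · simpa using mul_nonneg hpq hpr
  have hq := hp.trans_le hpq
  have hr := hp.trans_le hpr
  have h := Real.log_le_sub_one_of_pos (div_pos (mul_pos hq hr) hp)
  rw [Real.log_div (mul_pos hq hr).ne' hp.ne', Real.log_mul hq.ne' hr.ne'] at h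
  have h' := mul_le_mul_of_nonneg_left h hp.le
  have : p * (q * r / p - 1) = q * r - p := by field_simp
  simp only [Real.negMulLog]
  nlinarith

theorem measurableSet_preimage_of_singleton [Finite κ] {Z : X → κ}
    (hZ : ∀ k, MeasurableSet (Z ⁻¹' {k})) (s : Set κ) : MeasurableSet (Z ⁻¹' s) := by
  rw [← Set.biUnion_preimage_singleton]
  exact MeasurableSet.biUnion s.to_countable fun k _ => hZ k

theorem sum_measureReal_fiber_comp [Fintype κ] [DecidableEq ι] (μ : Measure X) [IsFiniteMeasure μ]
    {Z : X → κ} (hZ : ∀ k, MeasurableSet (Z ⁻¹' {k})) (g : κ → ι) (i : ι) :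
    ∑ k with g k = i, μ.real (Z ⁻¹' {k}) = μ.real ((g ∘ Z) ⁻¹' {i}) := by
  rw [sum_measureReal_preimage_singleton _ fun k _ => hZ k]
  congr 1
  ext x
  simp

theorem sum_measureReal_fiber [Fintype κ] (μ : Measure X) [IsProbabilityMeasure μ]
    {Z : X → κ} (hZ : ∀ k, MeasurableSet (Z ⁻¹' {k})) :
    ∑ k, μ.real (Z ⁻¹' {k}) = 1 := by
  rw [sum_measureReal_preimage_singleton _ fun k _ => hZ k]
  simp

theorem labelEntropy_nonneg [Fintype κ] (μ : Measure X) [IsProbabilityMeasure μ] (Z : X → κ) :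
    0 ≤ labelEntropy μ Z :=
  Finset.sum_nonneg fun _ _ => Real.negMulLog_nonneg measureReal_nonneg measureReal_le_one

theorem labelEntropy_comp_le [Fintype κ] [Fintype ι] (μ : Measure X) [IsFiniteMeasure μ]
    {Z : X → κ} (hZ : ∀ k, MeasurableSet (Z ⁻¹' {k})) (g : κ → ι) :
    labelEntropy μ (g ∘ Z) ≤ labelEntropy μ Z := by
  classical
  unfold labelEntropy
  rw [← Finset.sum_fiberwise Finset.univ g fun k => Real.negMulLog (μ.real (Z ⁻¹' {k}))]
  refine Finset.sum_le_sum fun i _ => ?_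
  rw [← sum_measureReal_fiber_comp μ hZ g i]
  exact negMulLog_sum_le fun _ _ => measureReal_nonneg

theorem labelEntropy_congr_ae [Fintype κ] {μ : Measure X} {Z W : X → κ} (h : Z =ᵐ[μ] W) :
    labelEntropy μ Z = labelEntropy μ W := by
  refine Finset.sum_congr rfl fun k _ => ?_
  congr 1
  refine measureReal_congr ?_
  filter_upwards [h] with x hx
  exact congrArg (fun y => y = k) hx

theorem labelEntropy_prod_le [Fintype κ] [Fintype ι] (μ : Measure X) [IsProbabilityMeasure μ]
    {Z : X → κ} {W : X → ι} (hZ : ∀ k, MeasurableSet (Z ⁻¹' {k}))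
    (hW : ∀ i, MeasurableSet (W ⁻¹' {i})) :
    labelEntropy μ (fun x => (Z x, W x)) ≤ labelEntropy μ Z + labelEntropy μ W := by
  classical
  set P : κ × ι → ℝ := fun y => μ.real ((fun x => (Z x, W x)) ⁻¹' {y}) with hP
  have hmeas : ∀ y : κ × ι, MeasurableSet ((fun x => (Z x, W x)) ⁻¹' {y}) := by
    rintro ⟨k, i⟩
    convert (hZ k).inter (hW i) using 1
    ext x
    simp
  have hleft : ∀ k, ∑ i, P (k, i) = μ.real (Z ⁻¹' {k}) := fun k => by
    have := sum_measureReal_fiber_comp μ hmeas Prod.fst k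
    rw [show (Prod.fst ∘ fun x => (Z x, W x)) = Z from rfl] at this
    rw [← this, Finset.sum_filter, Fintype.sum_prod_type, Finset.sum_eq_single k] <;>
      simp +contextual [hP]
  have hright : ∀ i, ∑ k, P (k, i) = μ.real (W ⁻¹' {i}) := fun i => by
    have := sum_measureReal_fiber_comp μ hmeas Prod.snd i
    rw [show (Prod.snd ∘ fun x => (Z x, W x)) = W from rfl] at this
    rw [← this, Finset.sum_filter, Fintype.sum_prod_type_right, Finset.sum_eq_single i] <;>
      simp +contextual [hP]
  have hterm : ∀ k i, Real.negMulLog (P (k, i)) ≤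
      -P (k, i) * Real.log (μ.real (Z ⁻¹' {k})) + -P (k, i) * Real.log (μ.real (W ⁻¹' {i})) +
        (μ.real (Z ⁻¹' {k}) * μ.real (W ⁻¹' {i}) - P (k, i)) := fun k i =>
    negMulLog_le_of_mul measureReal_nonneg
      (measureReal_mono fun x hx => congrArg Prod.fst hx)
      (measureReal_mono fun x hx => congrArg Prod.snd hx)
  have hone : ∑ k, ∑ i, P (k, i) = 1 := by
    simp_rw [hleft]
    exact sum_measureReal_fiber μ hZ
  calc labelEntropy μ (fun x => (Z x, W x)) = ∑ k, ∑ i, Real.negMulLog (P (k, i)) := by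
        rw [labelEntropy, Fintype.sum_prod_type]
    _ ≤ ∑ k, ∑ i, (-P (k, i) * Real.log (μ.real (Z ⁻¹' {k})) +
          -P (k, i) * Real.log (μ.real (W ⁻¹' {i})) +
          (μ.real (Z ⁻¹' {k}) * μ.real (W ⁻¹' {i}) - P (k, i))) :=
        Finset.sum_le_sum fun k _ => Finset.sum_le_sum fun i _ => hterm k i
    _ = labelEntropy μ Z + labelEntropy μ W := by
        simp only [Finset.sum_add_distrib, Finset.sum_sub_distrib]
        rw [hone, ← Finset.sum_mul_sum, sum_measureReal_fiber μ hZ, sum_measureReal_fiber μ hW]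
        rw [Finset.sum_comm (f := fun k i => -P (k, i) * Real.log (μ.real (W ⁻¹' {i})))]
        simp_rw [← Finset.sum_mul, Finset.sum_neg_distrib, hleft, hright]
        simp [labelEntropy, Real.negMulLog]

theorem labelEntropy_comp_measurePreserving [Fintype κ] {μ : Measure X} {f : X → X}
    (hf : MeasurePreserving f μ μ) {Z : X → κ} (hZ : ∀ k, MeasurableSet (Z ⁻¹' {k})) :
    labelEntropy μ (Z ∘ f) = labelEntropy μ Z := by
  refine Finset.sum_congr rfl fun k _ => ?_
  rw [Set.preimage_comp, measureReal_def, hf.measure_preimage (hZ k).nullMeasurableSet,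
    measureReal_def]

/-- Mixing two measures adds at most the entropy of the mixing weights. -/
theorem labelEntropy_le_of_mix [Fintype κ] {μ μ₁ μ₂ : Measure X} [IsProbabilityMeasure μ₁]
    [IsProbabilityMeasure μ₂] {a b : ℝ} (ha : 0 ≤ a) (hb : 0 ≤ b)
    (hμ : ∀ s, MeasurableSet s → μ.real s = a * μ₁.real s + b * μ₂.real s)
    {Z : X → κ} (hZ : ∀ k, MeasurableSet (Z ⁻¹' {k})) :
    labelEntropy μ Z ≤ a * labelEntropy μ₁ Z + b * labelEntropy μ₂ Z +
      (Real.negMulLog a + Real.negMulLog b) := by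
  calc labelEntropy μ Z ≤ ∑ k, (Real.negMulLog (a * μ₁.real (Z ⁻¹' {k})) +
        Real.negMulLog (b * μ₂.real (Z ⁻¹' {k}))) := by
        refine Finset.sum_le_sum fun k _ => ?_
        rw [hμ _ (hZ k)]
        exact negMulLog_add_le (by positivity) (by positivity)
    _ = _ := by
        simp only [Real.negMulLog_mul, Finset.sum_add_distrib, ← Finset.mul_sum, ← Finset.sum_mul,
          sum_measureReal_fiber _ hZ, labelEntropy]
        ring

theorem le_labelEntropy_of_mix [Fintype κ] [Fintype ι] {ν : Measure X} {τ : ι → Measure X}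
    {w : ι → ℝ} (hw : ∀ i, 0 ≤ w i) (hw1 : ∑ i, w i = 1)
    (hν : ∀ s, MeasurableSet s → ν.real s = ∑ i, w i * (τ i).real s)
    {Z : X → κ} (hZ : ∀ k, MeasurableSet (Z ⁻¹' {k})) :
    ∑ i, w i * labelEntropy (τ i) Z ≤ labelEntropy ν Z := by
  simp only [labelEntropy, Finset.mul_sum]
  rw [Finset.sum_comm]
  refine Finset.sum_le_sum fun k _ => ?_
  rw [hν _ (hZ k)]
  simpa using Real.concaveOn_negMulLog.le_map_sum (t := Finset.univ) (w := w)
    (p := fun i => (τ i).real (Z ⁻¹' {k})) (fun i _ => hw i) hw1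
    (fun i _ => Set.mem_Ici.2 measureReal_nonneg)

theorem preimage_itinerary {Y : Type*} (f : Y → Y) (c : Y → ι) (n : ℕ) (w : Fin n → ι) :
    itinerary f c n ⁻¹' {w} = ⋂ j : Fin n, f^[j] ⁻¹' (c ⁻¹' {w j}) := by
  ext x
  simp [itinerary, funext_iff]

theorem measurableSet_preimage_itinerary {f : X → X} (hf : Measurable f) {c : X → ι}
    (hc : ∀ i, MeasurableSet (c ⁻¹' {i})) (n : ℕ) (w : Fin n → ι) :
    MeasurableSet (itinerary f c n ⁻¹' {w}) := by
  rw [preimage_itinerary]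
  exact MeasurableSet.iInter fun j => hf.iterate _ (hc _)

variable [Fintype ι] {f : X → X} {μ : Measure X} [IsProbabilityMeasure μ] {c : X → ι}

theorem subadditive_labelEntropy (hf : MeasurePreserving f μ μ)
    (hc : ∀ i, MeasurableSet (c ⁻¹' {i})) :
    Subadditive fun n => labelEntropy μ (itinerary f c n) := by
  intro m n
  have hm := measurableSet_preimage_itinerary hf.measurable hc
  have hn : ∀ w, MeasurableSet ((itinerary f c n ∘ f^[m]) ⁻¹' {w}) := fun w =>
    hf.measurable.iterate m (hm n w)
  have hpair : itinerary f c (m + n) = (fun y : (Fin m → ι) × (Fin n → ι) => Fin.append y.1 y.2) ∘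
      fun x => (itinerary f c m x, (itinerary f c n ∘ f^[m]) x) := by
    funext x j
    refine Fin.addCases (fun i => ?_) (fun i => ?_) j
    · simp [itinerary]
    · simp [itinerary, ← Function.iterate_add_apply, add_comm]
  have hprod : ∀ y, MeasurableSet
      ((fun x => (itinerary f c m x, (itinerary f c n ∘ f^[m]) x)) ⁻¹' {y}) := by
    rintro ⟨v, w⟩
    convert (hm m v).inter (hn w) using 1
    ext x
    simp
  dsimp only
  rw [hpair]
  refine (labelEntropy_comp_le μ hprod _).trans ((labelEntropy_prod_le μ (hm m) hn).trans_eq ?_)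
  rw [labelEntropy_comp_measurePreserving (hf.iterate m) (hm n)]

theorem bddBelow_labelEntropy_div (f : X → X) (μ : Measure X) [IsProbabilityMeasure μ]
    (c : X → ι) : BddBelow (range fun n : ℕ => labelEntropy μ (itinerary f c n) / n) :=
  ⟨0, by rintro _ ⟨n, rfl⟩; exact div_nonneg (labelEntropy_nonneg _ _) n.cast_nonneg⟩

theorem bddBelow_range_labelEntropy_div (f : X → X) (μ : Measure X) [IsProbabilityMeasure μ]
    (c : X → ι) : BddBelow (range fun n : ℕ =>
      labelEntropy μ (itinerary f c (n + 1)) / ((n + 1 : ℕ) : ℝ)) :=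
  ⟨0, by rintro _ ⟨n, rfl⟩; exact div_nonneg (labelEntropy_nonneg _ _) (Nat.cast_nonneg _)⟩

theorem labelRate_le (f : X → X) (μ : Measure X) [IsProbabilityMeasure μ] (c : X → ι) (n : ℕ) :
    labelRate f μ c ≤ labelEntropy μ (itinerary f c (n + 1)) / ((n + 1 : ℕ) : ℝ) :=
  ciInf_le (bddBelow_range_labelEntropy_div f μ c) n

theorem labelRate_nonneg (f : X → X) (μ : Measure X) [IsProbabilityMeasure μ] (c : X → ι) :
    0 ≤ labelRate f μ c :=
  le_ciInf fun _ => div_nonneg (labelEntropy_nonneg _ _) (Nat.cast_nonneg _)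

theorem tendsto_labelRate (hf : MeasurePreserving f μ μ)
    (hc : ∀ i, MeasurableSet (c ⁻¹' {i})) :
    Tendsto (fun n : ℕ => labelEntropy μ (itinerary f c n) / n) atTop (𝓝 (labelRate f μ c)) := by
  have hlim := (subadditive_labelEntropy hf hc).tendsto_lim (bddBelow_labelEntropy_div f μ c)
  convert hlim using 2
  refine le_antisymm (ge_of_tendsto ((tendsto_add_atTop_iff_nat 1).2 hlim)
    (Eventually.of_forall fun n => labelRate_le f μ c n)) ?_
  exact le_ciInf fun n => (subadditive_labelEntropy hf hc).lim_le_div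
    (bddBelow_labelEntropy_div f μ c) n.succ_ne_zero

end LabelEntropy

section CoverRate

variable {X ι : Type*} [MeasurableSpace X]

/-- Measurable labellings of `X` whose fibre over `i` is contained in `V i`. -/
def adaptedLabels (V : ι → Set X) : Set (X → ι) :=
  {c | (∀ i, MeasurableSet (c ⁻¹' {i})) ∧ ∀ x, x ∈ V (c x)}

/-- The least entropy rate of a partition subordinate to the cover `V`. -/
noncomputable def coverRate [Fintype ι] (f : X → X) (V : ι → Set X) (μ : Measure X) : ℝ :=
  ⨅ c : adaptedLabels V, labelRate f μ (c : X → ι)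

variable [Fintype ι]

theorem adaptedLabels_nonempty {V : ι → Set X} (hV : ∀ i, MeasurableSet (V i))
    (hcov : ∀ x, ∃ i, x ∈ V i) : (adaptedLabels V).Nonempty := by
  let e := Fintype.equivFin ι
  have hmin : ∀ x, ∃ i, x ∈ V i ∧ ∀ j, x ∈ V j → e i ≤ e j := fun x =>
    Set.exists_min_image {i | x ∈ V i} e (Set.toFinite _) (hcov x)
  choose c hc hc' using hmin
  refine ⟨c, fun i => ?_, hc⟩
  have : c ⁻¹' {i} = V i ∩ ⋂ j : {j // e j < e i}, (V j)ᶜ := by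
    ext x
    simp only [Set.mem_preimage, Set.mem_singleton_iff, Set.mem_inter_iff, Set.mem_iInter,
      Set.mem_compl_iff, Subtype.forall]
    constructor
    · rintro rfl
      exact ⟨hc x, fun j hj hx => (hc' x j hx).not_gt hj⟩
    · rintro ⟨hx, h⟩
      refine e.injective ((hc' x i hx).antisymm ?_)
      by_contra! hlt
      exact h _ hlt (hc x)
  rw [this]
  exact (hV i).inter (MeasurableSet.iInter fun j => (hV j).compl)

theorem coverRate_le {f : X → X} {V : ι → Set X} (μ : Measure X) [IsProbabilityMeasure μ]
    {c : X → ι} (hc : c ∈ adaptedLabels V) : coverRate f V μ ≤ labelRate f μ c :=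
  ciInf_le (f := fun c : adaptedLabels V => labelRate f μ (c : X → ι))
    ⟨0, by rintro _ ⟨c, rfl⟩; exact labelRate_nonneg f μ _⟩ ⟨c, hc⟩

theorem exists_labelRate_lt {f : X → X} {V : ι → Set X} (hV : (adaptedLabels V).Nonempty)
    {μ : Measure X} {t : ℝ} (ht : coverRate f V μ < t) :
    ∃ c ∈ adaptedLabels V, labelRate f μ c < t := by
  have := hV.to_subtype
  obtain ⟨c, hc⟩ := exists_lt_of_ciInf_lt ht
  exact ⟨c, c.2, hc⟩

theorem le_labelRate_of_mix {κ : Type*} [Fintype κ] {f : X → X} (hf : Measurable f)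
    {ν : Measure X} {τ : κ → Measure X} [∀ k, IsProbabilityMeasure (τ k)]
    {w : κ → ℝ} (hw : ∀ i, 0 ≤ w i) (hw1 : ∑ i, w i = 1)
    (hν : ∀ s, MeasurableSet s → ν.real s = ∑ i, w i * (τ i).real s)
    {c : X → ι} (hc : ∀ i, MeasurableSet (c ⁻¹' {i})) :
    ∑ k, w k * labelRate f (τ k) c ≤ labelRate f ν c := by
  refine le_ciInf fun n => ?_
  have h := le_labelEntropy_of_mix hw hw1 hν (measurableSet_preimage_itinerary hf hc (n + 1))
  refine le_trans ?_ (div_le_div_of_nonneg_right h (Nat.cast_nonneg (n + 1)))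
  rw [Finset.sum_div]
  refine Finset.sum_le_sum fun k _ => ?_
  rw [mul_div_assoc]
  exact mul_le_mul_of_nonneg_left (labelRate_le f (τ k) c n) (hw k)

theorem le_coverRate_of_mix {κ : Type*} [Fintype κ] {f : X → X} (hf : Measurable f)
    {V : ι → Set X} (hV : (adaptedLabels V).Nonempty)
    {ν : Measure X} {τ : κ → Measure X} [∀ k, IsProbabilityMeasure (τ k)]
    {w : κ → ℝ} (hw : ∀ i, 0 ≤ w i) (hw1 : ∑ i, w i = 1)
    (hν : ∀ s, MeasurableSet s → ν.real s = ∑ i, w i * (τ i).real s) :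
    ∑ k, w k * coverRate f V (τ k) ≤ coverRate f V ν := by
  have := hV.to_subtype
  exact le_ciInf fun c => (Finset.sum_le_sum fun k _ =>
    mul_le_mul_of_nonneg_left (coverRate_le (τ k) c.2) (hw k)).trans
      (le_labelRate_of_mix hf hw hw1 hν c.2.1)

/-- Labels of orbit segments agree with those of a modified labelling on invariant sets. -/
theorem itinerary_eqOn {Y κ : Type*} {f : Y → Y} {A : Set Y} (hA : MapsTo f A A) {c c' : Y → κ}
    (h : EqOn c c' A) (n : ℕ) : EqOn (itinerary f c n) (itinerary f c' n) A :=
  fun _ hx => funext fun j => h (hA.iterate j hx)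

theorem labelRate_congr_ae {f : X → X} {A : Set X} (hA : MapsTo f A A) {c c' : X → ι}
    (h : EqOn c c' A) {μ : Measure X} (hμ : ∀ᵐ x ∂μ, x ∈ A) :
    labelRate f μ c = labelRate f μ c' := by
  refine iInf_congr fun n => ?_
  rw [labelEntropy_congr_ae (hμ.mono fun x hx => itinerary_eqOn hA h (n + 1) hx)]

theorem labelRate_le_of_mix {f : X → X} {μ μ₁ μ₂ : Measure X} [IsProbabilityMeasure μ]
    [IsProbabilityMeasure μ₁] [IsProbabilityMeasure μ₂] {a b : ℝ} (ha : 0 ≤ a) (hb : 0 ≤ b)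
    (hμ : ∀ s, MeasurableSet s → μ.real s = a * μ₁.real s + b * μ₂.real s)
    (h : MeasurePreserving f μ μ) (h₁ : MeasurePreserving f μ₁ μ₁)
    (h₂ : MeasurePreserving f μ₂ μ₂) {c : X → ι} (hc : ∀ i, MeasurableSet (c ⁻¹' {i})) :
    labelRate f μ c ≤ a * labelRate f μ₁ c + b * labelRate f μ₂ c := by
  have hz : Tendsto (fun n : ℕ => (Real.negMulLog a + Real.negMulLog b) / n) atTop (𝓝 0) :=
    tendsto_const_nhds.div_atTop tendsto_natCast_atTop_atTop
  have hlim := (((tendsto_labelRate h₁ hc).const_mul a).add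
    ((tendsto_labelRate h₂ hc).const_mul b)).add hz
  rw [add_zero] at hlim
  refine le_of_tendsto_of_tendsto' (tendsto_labelRate h hc) hlim fun n => ?_
  have := div_le_div_of_nonneg_right (labelEntropy_le_of_mix ha hb hμ
    (measurableSet_preimage_itinerary h.measurable hc n)) (Nat.cast_nonneg (α := ℝ) n)
  refine this.trans_eq ?_
  ring

/-- Along a splitting by an invariant set, `coverRate` is convex. -/
theorem coverRate_le_of_mix {f : X → X} {V : ι → Set X} (hV : (adaptedLabels V).Nonempty)
    {μ μ₁ μ₂ : Measure X} [IsProbabilityMeasure μ]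
    [IsProbabilityMeasure μ₁] [IsProbabilityMeasure μ₂] {a b : ℝ} (ha : 0 ≤ a) (hb : 0 ≤ b)
    (hab : a + b = 1)
    (hμ : ∀ s, MeasurableSet s → μ.real s = a * μ₁.real s + b * μ₂.real s)
    (h : MeasurePreserving f μ μ) (h₁ : MeasurePreserving f μ₁ μ₁)
    (h₂ : MeasurePreserving f μ₂ μ₂) {A : Set X} (hA : MeasurableSet A) (hfA : f ⁻¹' A = A)
    (hA₁ : ∀ᵐ x ∂μ₁, x ∈ A) (hA₂ : ∀ᵐ x ∂μ₂, x ∈ Aᶜ) :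
    coverRate f V μ ≤ a * coverRate f V μ₁ + b * coverRate f V μ₂ := by
  classical
  refine le_of_forall_pos_le_add fun ε hε => ?_
  obtain ⟨c₁, hc₁, hr₁⟩ := exists_labelRate_lt hV (lt_add_of_pos_right (coverRate f V μ₁) hε)
  obtain ⟨c₂, hc₂, hr₂⟩ := exists_labelRate_lt hV (lt_add_of_pos_right (coverRate f V μ₂) hε)
  have hc : A.piecewise c₁ c₂ ∈ adaptedLabels V := by
    refine ⟨fun i => ?_, fun x => ?_⟩
    · rw [Set.piecewise_preimage]
      exact hA.ite (hc₁.1 i) (hc₂.1 i)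
    · by_cases hx : x ∈ A
      · simpa [hx] using hc₁.2 x
      · simpa [hx] using hc₂.2 x
  have hm : MapsTo f A A := fun x hx => by rwa [← hfA] at hx
  have hm' : MapsTo f Aᶜ Aᶜ := fun x hx => by
    rwa [← hfA, ← Set.preimage_compl] at hx
  have e₁ := labelRate_congr_ae hm (Set.piecewise_eqOn A c₁ c₂) hA₁
  have e₂ := labelRate_congr_ae hm' (Set.piecewise_eqOn_compl A c₁ c₂) hA₂
  have hle := labelRate_le_of_mix ha hb hμ h h₁ h₂ hc.1
  rw [e₁, e₂] at hle
  have := coverRate_le (f := f) μ hc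
  calc coverRate f V μ ≤ a * labelRate f μ₁ c₁ + b * labelRate f μ₂ c₂ := this.trans hle
    _ ≤ a * (coverRate f V μ₁ + ε) + b * (coverRate f V μ₂ + ε) := by gcongr
    _ = a * coverRate f V μ₁ + b * coverRate f V μ₂ + (a + b) * ε := by ring
    _ = _ := by rw [hab, one_mul]

end CoverRate

section Semicontinuity

variable {X ι : Type*} [MetricSpace X] [MeasurableSpace X] [BorelSpace X]

/-- A labelling adapted to an open cover can be changed so that its fibres contain open sets
filling the original fibres up to small measure. -/
theorem exists_adaptedLabel_isOpen_subset [Fintype ι] (τ : Measure X) [IsFiniteMeasure τ]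
    {V : ι → Set X}
    (hV : ∀ i, IsOpen (V i)) {c : X → ι} (hc : c ∈ adaptedLabels V) {ε : ℝ} (hε : 0 < ε) :
    ∃ O : ι → Set X, ∃ c' ∈ adaptedLabels V, (∀ i, IsOpen (O i)) ∧ (∀ i, O i ⊆ c' ⁻¹' {i}) ∧
      ∀ i, τ.real (c ⁻¹' {i} \ O i) < ε := by
  classical
  have hK : ∀ i, ∃ K ⊆ c ⁻¹' {i}, IsClosed K ∧ τ (c ⁻¹' {i} \ K) < ENNReal.ofReal ε := fun i =>
    (hc.1 i).exists_isClosed_sdiff_lt (measure_ne_top τ _) (ENNReal.ofReal_pos.2 hε).ne'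
  choose K hKc hKcl hKε using hK
  set O : ι → Set X := fun i => V i ∩ ⋂ j : {j // j ≠ i},
    {x | Metric.infEDist x (K i) < Metric.infEDist x (K j)} with hO
  have hOopen : ∀ i, IsOpen (O i) := fun i => (hV i).inter (isOpen_iInter_of_finite fun j =>
    isOpen_lt Metric.continuous_infEDist Metric.continuous_infEDist)
  have hOuniq : ∀ {x i j}, x ∈ O i → x ∈ O j → i = j := fun {x i j} hi hj => by
    by_contra hne
    have h1 : Metric.infEDist x (K i) < Metric.infEDist x (K j) :=
      Set.mem_iInter.1 hi.2 ⟨j, Ne.symm hne⟩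
    have h2 : Metric.infEDist x (K j) < Metric.infEDist x (K i) :=
      Set.mem_iInter.1 hj.2 ⟨i, hne⟩
    exact lt_asymm h1 h2
  have hKO : ∀ i, K i ⊆ O i := fun i x hx => by
    have hxi : c x = i := hKc i hx
    refine ⟨hxi ▸ hc.2 x, Set.mem_iInter.2 fun j => ?_⟩
    rw [Set.mem_ofPred_eq, Metric.infEDist_zero_of_mem hx, pos_iff_ne_zero, Ne,
      ← Metric.mem_iff_infEDist_zero_of_closed (hKcl _)]
    intro hxj
    exact j.2 ((hKc j hxj).symm.trans hxi)
  let c' : X → ι := fun x => if h : ∃ i, x ∈ O i then h.choose else c x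
  have hc'O : ∀ {x i}, x ∈ O i → c' x = i := fun {x i} hx => by
    have h : ∃ i, x ∈ O i := ⟨i, hx⟩
    simp only [c', dif_pos h]
    exact hOuniq h.choose_spec hx
  have hc'n : ∀ {x}, (¬ ∃ i, x ∈ O i) → c' x = c x := fun {x} hx => by
    simp only [c', dif_neg hx]
  refine ⟨O, c', ⟨fun i => ?_, fun x => ?_⟩, hOopen, fun i x hx => hc'O hx, fun i => ?_⟩
  · have : c' ⁻¹' {i} = O i ∪ (c ⁻¹' {i} \ ⋃ j, O j) := by
      ext x
      by_cases h : ∃ j, x ∈ O j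
      · obtain ⟨j, hj⟩ := h
        have : ∃ j, x ∈ O j := ⟨j, hj⟩
        simp only [Set.mem_preimage, hc'O hj, Set.mem_singleton_iff, Set.mem_union, Set.mem_sdiff,
          Set.mem_iUnion, this, not_true_eq_false, and_false, or_false]
        exact ⟨fun h => h ▸ hj, fun h => hOuniq hj h⟩
      · have hi : x ∉ O i := fun hi => h ⟨i, hi⟩
        simp [hc'n h, h, hi]
    rw [this]
    exact (hOopen i).measurableSet.union
      ((hc.1 i).diff (MeasurableSet.iUnion fun j => (hOopen j).measurableSet))
  · by_cases h : ∃ j, x ∈ O j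
    · obtain ⟨j, hj⟩ := h
      rw [hc'O hj]
      exact hj.1
    · rw [hc'n h]
      exact hc.2 x
  · refine (measureReal_mono (Set.sdiff_subset_sdiff_right (hKO i))).trans_lt ?_
    exact (ENNReal.lt_ofReal_iff_toReal_lt (measure_ne_top τ _)).1 (hKε i)

theorem eventually_lt_measureReal_of_isOpen {τ₀ : ProbabilityMeasure X} {G : Set X}
    (hG : IsOpen G) {r : ℝ} (hr : r < (τ₀ : Measure X).real G) :
    ∀ᶠ τ : ProbabilityMeasure X in 𝓝 τ₀, r < (τ : Measure X).real G := by
  rcases lt_or_ge r 0 with h0 | h0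
  · exact Eventually.of_forall fun τ => h0.trans_le measureReal_nonneg
  have hlt : ENNReal.ofReal r < liminf (fun τ : ProbabilityMeasure X => (τ : Measure X) G)
      (𝓝 τ₀) :=
    ((ENNReal.ofReal_lt_iff_lt_toReal h0 (measure_ne_top _ _)).2 hr).trans_le
      (ProbabilityMeasure.le_liminf_measure_open_of_tendsto tendsto_id hG)
  filter_upwards [eventually_lt_of_lt_liminf hlt] with τ hτ
  exact (ENNReal.ofReal_lt_iff_lt_toReal h0 (measure_ne_top _ _)).1 hτ

theorem abs_sub_le_of_forall_sub_le {κ : Type*} [Fintype κ] {p q : κ → ℝ}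
    (hsum : ∑ k, p k = ∑ k, q k) {ε : ℝ} (hε : 0 ≤ ε) (h : ∀ k, p k - ε ≤ q k) (k : κ) :
    |q k - p k| ≤ Fintype.card κ * ε := by
  classical
  have hcard : (1 : ℝ) ≤ Fintype.card κ := by
    exact_mod_cast Fintype.card_pos_iff.2 ⟨k⟩
  have hrest : ∑ l ∈ Finset.univ.erase k, (p l - q l) ≤ Fintype.card κ * ε := by
    refine (Finset.sum_le_card_nsmul _ _ ε fun l _ => by linarith [h l]).trans ?_
    rw [nsmul_eq_mul]
    gcongr
    exact Finset.card_le_univ _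
  have hall : ∑ l, (p l - q l) = 0 := by rw [Finset.sum_sub_distrib, hsum, sub_self]
  rw [← Finset.add_sum_erase _ _ (Finset.mem_univ k)] at hall
  rw [abs_le]
  constructor
  · nlinarith [h k]
  · linarith

theorem upperSemicontinuousOn_coverRate [Fintype ι] {f : X → X} (hf : Continuous f)
    {V : ι → Set X} (hV : ∀ i, IsOpen (V i)) (hne : (adaptedLabels V).Nonempty) :
    UpperSemicontinuousOn (fun τ : ProbabilityMeasure X => coverRate f V (τ : Measure X))
      {τ | (τ : Measure X).map f = τ} := by
  classical
  intro τ₀ hτ₀ t ht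
  have hpres : MeasurePreserving f (τ₀ : Measure X) τ₀ := ⟨hf.measurable, hτ₀⟩
  obtain ⟨c, hc, hct⟩ := exists_labelRate_lt hne ht
  obtain ⟨n, hn⟩ := exists_lt_of_ciInf_lt hct
  set N := n + 1 with hN
  set p : (Fin N → ι) → ℝ := fun w => (τ₀ : Measure X).real (itinerary f c N ⁻¹' {w}) with hp
  have hcont : Continuous fun q : (Fin N → ι) → ℝ => (∑ w, Real.negMulLog (q w)) / (N : ℝ) := by
    fun_prop
  obtain ⟨η, hη, hηt⟩ := Metric.eventually_nhds_iff.1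
    ((hcont.tendsto p).eventually (gt_mem_nhds (show _ < t from hn)))
  set M : ℝ := Fintype.card (Fin N → ι) + 1 with hM
  have hMpos : 0 < M := by positivity
  set ε := η / M with hε
  have hεpos : 0 < ε := by positivity
  obtain ⟨O, c', hc', hOopen, hOc', hOε⟩ := exists_adaptedLabel_isOpen_subset (τ₀ : Measure X) hV hc
    (show 0 < ε / (2 * N) by positivity)
  have hGopen : ∀ w : Fin N → ι, IsOpen (⋂ j : Fin N, f^[j] ⁻¹' O (w j)) := fun w =>
    isOpen_iInter_of_finite fun j => (hOopen _).preimage (hf.iterate _)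
  have hGp : ∀ w, p w - ε < (τ₀ : Measure X).real (⋂ j : Fin N, f^[j] ⁻¹' O (w j)) := fun w => by
    have hsub : itinerary f c N ⁻¹' {w} ⊆ (⋂ j : Fin N, f^[j] ⁻¹' O (w j)) ∪
        ⋃ j : Fin N, f^[j] ⁻¹' (c ⁻¹' {w j} \ O (w j)) := by
      intro x hx
      rw [preimage_itinerary] at hx
      by_cases h : ∀ j : Fin N, f^[j] x ∈ O (w j)
      · exact Or.inl (Set.mem_iInter.2 h)
      · push Not at h
        obtain ⟨j, hj⟩ := h
        exact Or.inr (Set.mem_iUnion.2 ⟨j, Set.mem_iInter.1 hx j, hj⟩)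
    have hrem : (τ₀ : Measure X).real (⋃ j : Fin N, f^[j] ⁻¹' (c ⁻¹' {w j} \ O (w j))) ≤ ε / 2 := by
      refine (measureReal_iUnion_fintype_le _).trans ?_
      calc _ ≤ ∑ _j : Fin N, ε / (2 * N) := Finset.sum_le_sum fun j _ => by
            rw [measureReal_def, (hpres.iterate j).measure_preimage
              ((hc.1 _).diff (hOopen _).measurableSet).nullMeasurableSet]
            exact (hOε (w j)).le
        _ = ε / 2 := by
            have : (N : ℝ) ≠ 0 := by positivity
            simp
            field_simp
    have := (measureReal_mono (μ := (τ₀ : Measure X)) hsub).trans (measureReal_union_le _ _)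
    simp only [hp]
    linarith
  have hev : ∀ᶠ τ : ProbabilityMeasure X in 𝓝 τ₀, ∀ w : Fin N → ι,
      p w - ε < (τ : Measure X).real (⋂ j : Fin N, f^[j] ⁻¹' O (w j)) :=
    eventually_all.2 fun w => eventually_lt_measureReal_of_isOpen (hGopen w) (hGp w)
  refine Filter.Eventually.filter_mono nhdsWithin_le_nhds ?_
  filter_upwards [hev] with τ hτ
  set q : (Fin N → ι) → ℝ := fun w => (τ : Measure X).real (itinerary f c' N ⁻¹' {w}) with hq
  have hpq : ∀ w, p w - ε ≤ q w := fun w => (hτ w).le.trans <| measureReal_mono <| by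
    rw [preimage_itinerary]
    exact Set.iInter_mono fun j => Set.preimage_mono (hOc' _)
  have hsum : ∑ w, p w = ∑ w, q w := by
    rw [sum_measureReal_fiber _ (measurableSet_preimage_itinerary hf.measurable hc.1 N),
      sum_measureReal_fiber _ (measurableSet_preimage_itinerary hf.measurable hc'.1 N)]
  have hdist : dist q p < η := (dist_pi_lt_iff hη).2 fun w => by
    rw [Real.dist_eq]
    refine (abs_sub_le_of_forall_sub_le hsum hεpos.le hpq w).trans_lt ?_
    calc _ < M * ε := by gcongr; simp [hM]
      _ = η := by rw [hε]; field_simp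
  exact ((coverRate_le _ hc').trans (labelRate_le f _ c' n)).trans_lt (hηt hdist)

end Semicontinuity

section ErgodicMaximizer

variable {X : Type*} [MetricSpace X] [CompactSpace X] [MeasurableSpace X] [BorelSpace X]

theorem integrable_of_continuous {φ : X → ℝ} (hφ : Continuous φ) (μ : Measure X)
    [IsFiniteMeasure μ] : Integrable φ μ :=
  (BoundedContinuousFunction.mkOfCompact ⟨φ, hφ⟩).integrable μ

/-- Integrals of continuous functions against a mixture of two measures. -/
theorem integral_mix {μ μ₁ μ₂ : Measure X} [IsFiniteMeasure μ₁]
    [IsFiniteMeasure μ₂] {a b : ℝ} (ha : 0 ≤ a) (hb : 0 ≤ b)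
    (hμ : μ = ENNReal.ofReal a • μ₁ + ENNReal.ofReal b • μ₂) {φ : X → ℝ} (hφ : Continuous φ) :
    ∫ x, φ x ∂μ = a * ∫ x, φ x ∂μ₁ + b * ∫ x, φ x ∂μ₂ := by
  rw [hμ, integral_add_measure
    ((integrable_of_continuous hφ μ₁).smul_measure ENNReal.ofReal_ne_top)
    ((integrable_of_continuous hφ μ₂).smul_measure ENNReal.ofReal_ne_top)]
  simp [ha, hb]

theorem continuous_integral_continuousMap (μ : Measure X) [IsProbabilityMeasure μ] :
    Continuous fun g : C(X, ℝ) => ∫ x, g x ∂μ := by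
  refine (LipschitzWith.of_dist_le_mul (K := 1) fun g h => ?_).continuous
  rw [dist_eq_norm, dist_eq_norm, ← integral_sub (integrable_of_continuous g.continuous μ)
    (integrable_of_continuous h.continuous μ)]
  have := norm_integral_le_of_norm_le_const (μ := μ) (f := fun x => g x - h x)
    (Eventually.of_forall fun x => (g - h).norm_coe_le_norm x)
  simpa using this

/-- On probability measures of a compact metric space there is a bounded continuous functional
that is strictly convex. -/
theorem exists_strictConvex_functional (X : Type*) [MetricSpace X] [CompactSpace X]
    [MeasurableSpace X] [BorelSpace X] :
    ∃ Ψ : ProbabilityMeasure X → ℝ, Continuous Ψ ∧ (∀ τ, 0 ≤ Ψ τ) ∧ (∀ τ, Ψ τ ≤ 2) ∧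
      ∀ (μ μ₁ μ₂ : ProbabilityMeasure X) (a b : ℝ), 0 < a → 0 < b → a + b = 1 → μ₁ ≠ μ₂ →
        (μ : Measure X) =
          ENNReal.ofReal a • (μ₁ : Measure X) + ENNReal.ofReal b • (μ₂ : Measure X) →
        Ψ μ < a * Ψ μ₁ + b * Ψ μ₂ := by
  let φ : ℕ → C(X, ℝ) := TopologicalSpace.denseSeq C(X, ℝ)
  let T : ℕ → ProbabilityMeasure X → ℝ := fun n τ =>
    (1 / 2) ^ n * ((∫ x, φ n x ∂(τ : Measure X)) ^ 2 / (1 + ‖φ n‖ ^ 2))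
  have hT0 : ∀ n τ, 0 ≤ T n τ := fun n τ => by positivity
  have hT1 : ∀ n τ, T n τ ≤ (1 / 2) ^ n := fun n τ => by
    have hb : |∫ x, φ n x ∂(τ : Measure X)| ≤ ‖φ n‖ := by
      have := norm_integral_le_of_norm_le_const (μ := (τ : Measure X)) (f := fun x => φ n x)
        (Eventually.of_forall fun x => (φ n).norm_coe_le_norm x)
      simpa using this
    refine mul_le_of_le_one_right (by positivity) ((div_le_one (by positivity)).2 ?_)
    have := pow_le_pow_left₀ (abs_nonneg _) hb 2
    rw [sq_abs] at this
    linarith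
  have hgeo : Summable fun n : ℕ => (1 / 2 : ℝ) ^ n := summable_geometric_two
  have hsum : ∀ τ, Summable fun n => T n τ := fun τ =>
    Summable.of_nonneg_of_le (fun n => hT0 n τ) (fun n => hT1 n τ) hgeo
  refine ⟨fun τ => ∑' n, T n τ, ?_, fun τ => tsum_nonneg fun n => hT0 n τ, fun τ => ?_, ?_⟩
  · refine continuous_tsum (fun n => ?_) hgeo fun n τ => ?_
    · have := ProbabilityMeasure.continuous_integral_continuousMap (φ n)
      fun_prop
    · rw [Real.norm_of_nonneg (hT0 n τ)]
      exact hT1 n τ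
  · exact ((hsum τ).tsum_le_tsum (fun n => hT1 n τ) hgeo).trans_eq tsum_geometric_two
  intro μ μ₁ μ₂ a b ha hb hab hne hμ
  have hint : ∀ n, ∫ x, φ n x ∂(μ : Measure X) =
      a * ∫ x, φ n x ∂(μ₁ : Measure X) + b * ∫ x, φ n x ∂(μ₂ : Measure X) := fun n =>
    integral_mix ha.le hb.le hμ (φ n).continuous
  have hkey : ∀ n, a * T n μ₁ + b * T n μ₂ - T n μ =
      (1 / 2) ^ n * (a * b * (∫ x, φ n x ∂(μ₁ : Measure X) - ∫ x, φ n x ∂(μ₂ : Measure X)) ^ 2 /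
        (1 + ‖φ n‖ ^ 2)) := fun n => by
    simp only [T, hint]
    obtain rfl : b = 1 - a := by linarith
    field_simp
    ring
  obtain ⟨n, hn⟩ : ∃ n, ∫ x, φ n x ∂(μ₁ : Measure X) ≠ ∫ x, φ n x ∂(μ₂ : Measure X) := by
    by_contra! hall
    refine hne (ProbabilityMeasure.toMeasure_injective
      (ext_of_forall_integral_eq_of_IsFiniteMeasure fun g => ?_))
    have := (TopologicalSpace.denseRange_denseSeq C(X, ℝ)).equalizer
      (continuous_integral_continuousMap _) (continuous_integral_continuousMap _) (funext hall)
    exact congrFun this g.toContinuousMap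
  have hle : ∀ n, T n μ ≤ a * T n μ₁ + b * T n μ₂ := fun n => by
    have : 0 ≤ a * T n μ₁ + b * T n μ₂ - T n μ := by rw [hkey]; positivity
    linarith
  have hlt : T n μ < a * T n μ₁ + b * T n μ₂ := by
    have hsq : 0 < (∫ x, φ n x ∂(μ₁ : Measure X) - ∫ x, φ n x ∂(μ₂ : Measure X)) ^ 2 := by
      have := sub_ne_zero.2 hn
      positivity
    have : 0 < a * T n μ₁ + b * T n μ₂ - T n μ := by rw [hkey]; positivity
    linarith
  have hs₁ := (hsum μ₁).mul_left a
  have hs₂ := (hsum μ₂).mul_left b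
  refine ((hsum μ).tsum_lt_tsum hle hlt (hs₁.add hs₂)).trans_eq ?_
  rw [hs₁.tsum_add hs₂, tsum_mul_left, tsum_mul_left]

/-- A non-ergodic invariant measure splits along an invariant set. -/
theorem exists_mix_of_not_ergodic {Y : Type*} [MeasurableSpace Y] {f : Y → Y}
    {μ : ProbabilityMeasure Y} (hf : MeasurePreserving f (μ : Measure Y) μ)
    (hμ : ¬ Ergodic f (μ : Measure Y)) :
    ∃ (A : Set Y) (μ₁ μ₂ : ProbabilityMeasure Y) (a b : ℝ), MeasurableSet A ∧ f ⁻¹' A = A ∧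
      0 < a ∧ 0 < b ∧ a + b = 1 ∧
      (μ : Measure Y) =
        ENNReal.ofReal a • (μ₁ : Measure Y) + ENNReal.ofReal b • (μ₂ : Measure Y) ∧
      MeasurePreserving f (μ₁ : Measure Y) μ₁ ∧ MeasurePreserving f (μ₂ : Measure Y) μ₂ ∧
      (∀ᵐ x ∂(μ₁ : Measure Y), x ∈ A) ∧ ∀ᵐ x ∂(μ₂ : Measure Y), x ∈ Aᶜ := by
  obtain ⟨A, hA, hfA, hconst⟩ : ∃ A, MeasurableSet A ∧ f ⁻¹' A = A ∧
      ¬ EventuallyConst A (ae (μ : Measure Y)) := by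
    by_contra! h
    exact hμ ⟨hf, ⟨fun s hs hfs => h s hs hfs⟩⟩
  rw [eventuallyConst_set, not_or] at hconst
  have h1 : (μ : Measure Y) A ≠ 0 := fun h => hconst.2 (measure_eq_zero_iff_ae_notMem.1 h)
  have h2 : (μ : Measure Y) Aᶜ ≠ 0 := fun h => hconst.1 (mem_ae_iff.2 h)
  have hcond : ∀ B, MeasurableSet B → f ⁻¹' B = B →
      MeasurePreserving f (ProbabilityTheory.cond (μ : Measure Y) B)
        (ProbabilityTheory.cond (μ : Measure Y) B) := fun B hB hfB => by
    have := hf.restrict_preimage hB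
    rw [hfB] at this
    exact this.smul_measure _
  have hsmul : ∀ B, (μ : Measure Y) B ≠ 0 →
      ENNReal.ofReal ((μ : Measure Y).real B) • ProbabilityTheory.cond (μ : Measure Y) B =
        (μ : Measure Y).restrict B := fun B hB => by
    rw [ofReal_measureReal, ProbabilityTheory.cond, smul_smul,
      ENNReal.mul_inv_cancel hB (measure_ne_top _ _), one_smul]
  refine ⟨A, ⟨_, ProbabilityTheory.cond_isProbabilityMeasure h1⟩,
    ⟨_, ProbabilityTheory.cond_isProbabilityMeasure h2⟩, (μ : Measure Y).real A,
    (μ : Measure Y).real Aᶜ, hA, hfA, ?_, ?_, ?_, ?_, hcond A hA hfA,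
    hcond Aᶜ hA.compl (by rw [Set.preimage_compl, hfA]), ProbabilityTheory.ae_cond_mem hA,
    ProbabilityTheory.ae_cond_mem hA.compl⟩
  · exact ENNReal.toReal_pos h1 (measure_ne_top _ _)
  · exact ENNReal.toReal_pos h2 (measure_ne_top _ _)
  · exact (measureReal_add_measureReal_compl hA).trans (by simp)
  · simp only [ProbabilityMeasure.coe_mk, hsmul _ h1, hsmul _ h2]
    exact (Measure.restrict_add_restrict_compl hA).symm

/-- Up to `ε`, the functional `α ∫ φ + β coverRate` on invariant measures, where `0 ≤ β`, is
maximized by an ergodic measure. -/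
theorem exists_ergodic_ge {ι : Type*} [Fintype ι] {f : X → X} (hf : Continuous f)
    {V : ι → Set X} (hV : ∀ i, IsOpen (V i)) (hne : (adaptedLabels V).Nonempty)
    {φ : X → ℝ} (hφ : Continuous φ) {μ : ProbabilityMeasure X}
    (hμ : (μ : Measure X).map f = μ) (α : ℝ) {β ε : ℝ} (hβ : 0 ≤ β) (hε : 0 < ε) :
    ∃ τ : ProbabilityMeasure X, Ergodic f (τ : Measure X) ∧
      α * ∫ x, φ x ∂(μ : Measure X) + β * coverRate f V (μ : Measure X) - ε ≤
        α * ∫ x, φ x ∂(τ : Measure X) + β * coverRate f V (τ : Measure X) := by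
  obtain ⟨Ψ, hΨ, hΨ0, hΨ2, hΨconv⟩ := exists_strictConvex_functional X
  set M : Set (ProbabilityMeasure X) := {τ | (τ : Measure X).map f = τ} with hM
  have hMclosed : IsClosed M := by
    have : M = {τ | τ.map hf.aemeasurable = τ} := by
      ext τ
      simp only [hM, Set.mem_ofPred_eq]
      rw [← ProbabilityMeasure.toMeasure_injective.eq_iff, ProbabilityMeasure.toMeasure_map]
    rw [this]
    exact isClosed_eq (ProbabilityMeasure.continuous_map hf) continuous_id
  set G : ProbabilityMeasure X → ℝ := fun τ => α * ∫ x, φ x ∂(τ : Measure X) +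
    β * coverRate f V (τ : Measure X) + ε / 2 * Ψ τ with hG
  have hint : Continuous fun τ : ProbabilityMeasure X => ∫ x, φ x ∂(τ : Measure X) :=
    ProbabilityMeasure.continuous_integral_continuousMap (⟨φ, hφ⟩ : C(X, ℝ))
  have husc : UpperSemicontinuousOn G M := by
    have h1 := (continuous_const_mul β).comp_upperSemicontinuousOn
      (upperSemicontinuousOn_coverRate hf hV hne) (monotone_mul_left_of_nonneg hβ)
    exact (((hint.const_mul α).upperSemicontinuous.upperSemicontinuousOn M).add h1).add
      ((hΨ.const_mul (ε / 2)).upperSemicontinuous.upperSemicontinuousOn M)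
  obtain ⟨τ, hτ, hmax⟩ := UpperSemicontinuousOn.exists_isMaxOn ⟨μ, hμ⟩ hMclosed.isCompact husc
  refine ⟨τ, ?_, ?_⟩
  · by_contra herg
    have hpres : MeasurePreserving f (τ : Measure X) τ := ⟨hf.measurable, hτ⟩
    obtain ⟨A, τ₁, τ₂, a, b, hA, hfA, ha, hb, hab, hmix, h₁, h₂, hA₁, hA₂⟩ :=
      exists_mix_of_not_ergodic hpres herg
    have hreal : ∀ s, MeasurableSet s →
        (τ : Measure X).real s = a * (τ₁ : Measure X).real s + b * (τ₂ : Measure X).real s := by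
      intro s _
      rw [hmix]
      simp [measureReal_def, ENNReal.toReal_add, ENNReal.mul_ne_top, ha.le, hb.le]
    have hne12 : τ₁ ≠ τ₂ := by
      rintro rfl
      obtain ⟨x, hx, hx'⟩ := (hA₁.and hA₂).exists
      exact hx' hx
    have hcov := coverRate_le_of_mix hne ha.le hb.le hab hreal hpres h₁ h₂ hA hfA hA₁ hA₂
    have hphi := integral_mix ha.le hb.le hmix hφ
    have hpsi := hΨconv τ τ₁ τ₂ a b ha hb hab hne12 hmix
    have hm₁ : G τ₁ ≤ G τ := hmax h₁.map_eq
    have hm₂ : G τ₂ ≤ G τ := hmax h₂.map_eq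
    have hlt : G τ < a * G τ₁ + b * G τ₂ := by
      simp only [hG]
      rw [hphi]
      have e1 := mul_le_mul_of_nonneg_left hcov hβ
      have e2 := mul_lt_mul_of_pos_left hpsi (half_pos hε)
      linarith
    have : a * G τ₁ + b * G τ₂ ≤ (a + b) * G τ := by nlinarith
    rw [hab, one_mul] at this
    exact hlt.not_ge this
  · have hm : G μ ≤ G τ := hmax hμ
    simp only [hG] at hm
    nlinarith [hΨ0 μ, hΨ2 τ]

end ErgodicMaximizer

section Partitions

variable {X : Type*} [MeasurableSpace X]

theorem labelRate_comp_le {ι κ : Type*} [Fintype ι] [Fintype κ] {f : X → X} (hf : Measurable f)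
    (μ : Measure X) [IsProbabilityMeasure μ] {c : X → κ} (hc : ∀ k, MeasurableSet (c ⁻¹' {k}))
    (g : κ → ι) : labelRate f μ (g ∘ c) ≤ labelRate f μ c :=
  ciInf_mono (bddBelow_range_labelEntropy_div f μ _) fun n =>
    div_le_div_of_nonneg_right
      (labelEntropy_comp_le μ (measurableSet_preimage_itinerary hf hc (n + 1)) (g ∘ ·))
      (Nat.cast_nonneg _)

theorem partEntropy_dynRefine {f : X → X} (μ : Measure X) (ξ : FinBorelPartition X)
    {c : X → ξ.parts} (hc : ∀ x, x ∈ (c x : Set X)) (n : ℕ) :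
    partEntropy μ (dynRefine f ξ.parts n) = labelEntropy μ (itinerary f c n) := by
  classical
  have hfib : ∀ (x : X) (s : Set X) (hs : s ∈ ξ.parts), x ∈ s ↔ c x = ⟨s, hs⟩ := by
    refine fun x s hs => ⟨fun hx => ?_, fun h => by have := hc x; rwa [h] at this⟩
    by_contra hne
    exact Set.disjoint_left.1 (ξ.disj _ (c x).2 s hs fun h => hne (Subtype.ext h)) (hc x) hx
  have hcell : ∀ w (hw : w ∈ (Finset.range n).pi fun _ => ξ.parts),
      (⋂ (j : ℕ) (h : j ∈ Finset.range n), f^[j] ⁻¹' w j h) = itinerary f c n ⁻¹'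
        {fun j : Fin n => ⟨w j (Finset.mem_range.2 j.2), Finset.mem_pi.1 hw _ _⟩} := by
    intro w hw
    ext x
    simp only [Set.mem_iInter, Set.mem_preimage, Set.mem_singleton_iff, funext_iff, itinerary]
    exact ⟨fun h j => (hfib _ _ _).1 (h j _), fun h j hj =>
      (hfib _ _ (Finset.mem_pi.1 hw _ hj)).2 (h ⟨j, Finset.mem_range.1 hj⟩)⟩
  unfold partEntropy dynRefine labelEntropy
  rw [Finset.sum_image_of_disjoint (by simp)]
  · refine Finset.sum_bij' (fun w hw (j : Fin n) =>
      (⟨w j (Finset.mem_range.2 j.2), Finset.mem_pi.1 hw _ _⟩ : ξ.parts))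
      (fun v _ j hj => (v ⟨j, Finset.mem_range.1 hj⟩ : Set X)) (fun _ _ => Finset.mem_univ _)
      (fun v _ => Finset.mem_pi.2 fun _ _ => (v _).2) (fun _ _ => rfl) (fun _ _ => rfl)
      fun w hw => ?_
    rw [hcell w hw, measureReal_def]
  · intro w hw w' hw' hne
    simp only [Function.onFun]
    rw [hcell w hw, hcell w' hw']
    refine (Set.disjoint_singleton.2 fun h => hne ?_).preimage _
    funext j hj
    exact congrArg Subtype.val (congrFun h ⟨j, Finset.mem_range.1 hj⟩)

theorem FinBorelPartition.exists_label (ξ : FinBorelPartition X) :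
    ∃ c : X → ξ.parts, (∀ x, x ∈ (c x : Set X)) ∧ ∀ s, c ⁻¹' {s} = s := by
  choose c hc hxc using ξ.cover
  refine ⟨fun x => ⟨c x, hc x⟩, hxc, fun s => ?_⟩
  ext x
  simp only [Set.mem_preimage, Set.mem_singleton_iff]
  refine ⟨fun h => h ▸ hxc x, fun hx => Subtype.ext ?_⟩
  by_contra hne
  exact Set.disjoint_left.1 (ξ.disj _ (hc x) s s.2 hne) (hxc x) hx

theorem dynEntropy_eq_labelRate {f : X → X} {μ : Measure X} [IsProbabilityMeasure μ]
    (hf : MeasurePreserving f μ μ) (ξ : FinBorelPartition X) {c : X → ξ.parts}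
    (hc : ∀ x, x ∈ (c x : Set X)) (hc' : ∀ s, MeasurableSet (c ⁻¹' {s})) :
    dynEntropy f μ ξ = labelRate f μ c := by
  unfold dynEntropy
  simp only [partEntropy_dynRefine μ ξ hc]
  exact (tendsto_labelRate hf hc').limsup_eq

theorem coverRate_le_dynEntropy {f : X → X} {μ : Measure X} [IsProbabilityMeasure μ]
    (hf : MeasurePreserving f μ μ) {U : Finset (Set X)} {ξ : FinBorelPartition X}
    (hξ : ∀ s ∈ ξ.parts, ∃ u ∈ U, s ⊆ u) :
    coverRate f (fun u : U => (u : Set X)) μ ≤ dynEntropy f μ ξ := by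
  obtain ⟨c, hc, hfib⟩ := ξ.exists_label
  have hc' : ∀ s, MeasurableSet (c ⁻¹' {s}) := fun s => by
    rw [hfib]
    exact ξ.meas s s.2
  rw [dynEntropy_eq_labelRate hf ξ hc hc']
  choose g hgU hg using hξ
  let g' : ξ.parts → U := fun s => ⟨g s s.2, hgU s s.2⟩
  refine (coverRate_le μ (c := g' ∘ c) ⟨fun u => ?_, fun x => hg _ _ (hc x)⟩).trans
    (labelRate_comp_le hf.measurable μ hc' g')
  rw [Set.preimage_comp]
  exact measurableSet_preimage_of_singleton hc' _

theorem exists_partition_dynEntropy_le {f : X → X} {μ : Measure X} [IsProbabilityMeasure μ]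
    (hf : MeasurePreserving f μ μ) {U : Finset (Set X)} {c : X → U}
    (hc : c ∈ adaptedLabels fun u : U => (u : Set X)) :
    ∃ ξ : FinBorelPartition X, (∀ s ∈ ξ.parts, ∃ u ∈ U, s ⊆ u) ∧
      dynEntropy f μ ξ ≤ labelRate f μ c := by
  classical
  let ξ : FinBorelPartition X :=
    { parts := Finset.univ.image fun u => c ⁻¹' {u}
      meas := by
        intro s hs
        obtain ⟨u, -, rfl⟩ := Finset.mem_image.1 hs
        exact hc.1 u
      cover := fun x => ⟨c ⁻¹' {c x}, Finset.mem_image_of_mem _ (Finset.mem_univ _), rfl⟩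
      disj := by
        intro s hs t ht hst
        obtain ⟨u, -, rfl⟩ := Finset.mem_image.1 hs
        obtain ⟨v, -, rfl⟩ := Finset.mem_image.1 ht
        exact (Set.disjoint_singleton.2 fun h => hst (by rw [h])).preimage c }
  let g : U → ξ.parts := fun u =>
    ⟨c ⁻¹' {u}, Finset.mem_image_of_mem _ (Finset.mem_univ u)⟩
  refine ⟨ξ, fun s hs => ?_, ?_⟩
  · obtain ⟨u, -, rfl⟩ := Finset.mem_image.1 hs
    refine ⟨u, u.2, fun x hx => ?_⟩
    obtain rfl : c x = u := hx
    exact hc.2 x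
  · rw [dynEntropy_eq_labelRate hf ξ (c := g ∘ c) (fun x => rfl) fun s => ?_]
    · exact labelRate_comp_le hf.measurable μ hc.1 g
    · rw [Set.preimage_comp]
      exact measurableSet_preimage_of_singleton hc.1 _

end Partitions

section ErgodicCombination

variable {X : Type*} [MetricSpace X] [CompactSpace X] [MeasurableSpace X] [BorelSpace X]

/-- The integral of `φ` and the entropy rate of an invariant measure are approximated by convex
combinations of those of ergodic measures. -/
theorem mem_closure_convexHull_ergodic {ι : Type*} [Fintype ι] {f : X → X} (hf : Continuous f)
    {V : ι → Set X} (hV : ∀ i, IsOpen (V i)) (hne : (adaptedLabels V).Nonempty)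
    {φ : X → ℝ} (hφ : Continuous φ) {μ : ProbabilityMeasure X}
    (hμ : (μ : Measure X).map f = μ) :
    (∫ x, φ x ∂(μ : Measure X), coverRate f V (μ : Measure X)) ∈
      closure (convexHull ℝ {p : ℝ × ℝ | ∃ τ : ProbabilityMeasure X, Ergodic f (τ : Measure X) ∧
        p.1 = ∫ x, φ x ∂(τ : Measure X) ∧ p.2 ≤ coverRate f V (τ : Measure X)}) := by
  set S := {p : ℝ × ℝ | ∃ τ : ProbabilityMeasure X, Ergodic f (τ : Measure X) ∧
    p.1 = ∫ x, φ x ∂(τ : Measure X) ∧ p.2 ≤ coverRate f V (τ : Measure X)} with hS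
  by_contra hp
  obtain ⟨L, u, hLu, hu⟩ := geometric_hahn_banach_closed_point
    (convex_convexHull ℝ S).closure isClosed_closure hp
  have hL : ∀ x y : ℝ, L (x, y) = L (1, 0) * x + L (0, 1) * y := fun x y => by
    have : ((x, y) : ℝ × ℝ) = x • ((1, 0) : ℝ × ℝ) + y • ((0, 1) : ℝ × ℝ) := by simp
    rw [this, map_add, map_smul, map_smul, smul_eq_mul, smul_eq_mul, mul_comm x, mul_comm y]
  have hLS : ∀ p ∈ S, L p < u := fun p hp => hLu p (subset_closure (subset_convexHull ℝ S hp))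
  have hβ : 0 ≤ L (0, 1) := by
    obtain ⟨τ, hτ, -⟩ := exists_ergodic_ge hf hV hne hφ hμ 0 le_rfl one_pos
    by_contra! hneg
    set a := ∫ x, φ x ∂(τ : Measure X)
    set g := coverRate f V (τ : Measure X)
    have h1 := hLS (a, g) ⟨τ, hτ, rfl, le_rfl⟩
    have hk : 0 ≤ (u - L (a, g)) / -L (0, 1) := div_nonneg (by linarith) (by linarith)
    have h2 := hLS (a, g - (u - L (a, g)) / -L (0, 1)) ⟨τ, hτ, rfl, sub_le_self _ hk⟩
    rw [hL, mul_sub, ← add_sub_assoc, ← hL, div_neg, mul_neg, mul_div_cancel₀ _ hneg.ne] at h2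
    linarith
  obtain ⟨τ, hτ, hle⟩ := exists_ergodic_ge hf hV hne hφ hμ (L (1, 0)) hβ (sub_pos.2 hu)
  have := hLS (∫ x, φ x ∂(τ : Measure X), coverRate f V (τ : Measure X)) ⟨τ, hτ, rfl, le_rfl⟩
  rw [hL] at this
  rw [hL (∫ x, φ x ∂(μ : Measure X))] at hle hu
  linarith

theorem exists_ergodic_combination_approx {ι : Type*} [Fintype ι] {f : X → X}
    (hf : Continuous f) {V : ι → Set X} (hV : ∀ i, IsOpen (V i))
    (hne : (adaptedLabels V).Nonempty) {φ : X → ℝ} (hφ : Continuous φ)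
    {μ : ProbabilityMeasure X} (hμ : (μ : Measure X).map f = μ) {ε : ℝ} (hε : 0 < ε) :
    ∃ (j : ℕ) (w : Fin j → ℝ) (τ : Fin j → ProbabilityMeasure X), (∀ i, 0 < w i) ∧
      ∑ i, w i = 1 ∧ (∀ i, Ergodic f (τ i : Measure X)) ∧
      |∑ i, w i * ∫ x, φ x ∂(τ i : Measure X) - ∫ x, φ x ∂(μ : Measure X)| < ε ∧
      coverRate f V (μ : Measure X) < ∑ i, w i * coverRate f V (τ i : Measure X) + ε := by
  obtain ⟨q, hq, hdist⟩ := Metric.mem_closure_iff.1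
    (mem_closure_convexHull_ergodic hf hV hne hφ hμ) ε hε
  obtain ⟨κ, _, z, w, hz, -, hw, hw1, rfl⟩ := eq_pos_convex_span_of_mem_convexHull hq
  choose τ hτ hz1 hz2 using fun k => hz (mem_range_self k)
  let e := (Fintype.equivFin κ).symm
  rw [Prod.dist_eq, max_lt_iff, Real.dist_eq, Real.dist_eq, Prod.fst_sum, Prod.snd_sum] at hdist
  simp only [Prod.smul_fst, Prod.smul_snd, smul_eq_mul, hz1] at hdist
  refine ⟨Fintype.card κ, w ∘ e, τ ∘ e, fun i => hw _, (e.sum_comp w).trans hw1,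
    fun i => hτ _, ?_, ?_⟩
  · rw [abs_sub_comm]
    refine lt_of_eq_of_lt ?_ hdist.1
    rw [← e.sum_comp]
    rfl
  · have h := (abs_lt.1 hdist.2).2
    have hle : ∑ k, w k * (z k).2 ≤ ∑ i, (w ∘ e) i * coverRate f V ((τ ∘ e) i : Measure X) := by
      rw [← e.sum_comp]
      exact Finset.sum_le_sum fun i _ => mul_le_mul_of_nonneg_left (hz2 _) (hw _).le
    linarith

end ErgodicCombination

/-- Lemma 3.3: approximation of an invariant measure by a finite convex combination of
ergodic measures, keeping the partition entropies over a fixed finite open cover and the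
integral of `φ` under control. -/
theorem approximation_by_ergodic_combination
    {X : Type*} [MetricSpace X] [CompactSpace X] [MeasurableSpace X] [BorelSpace X]
    (f : X → X) (hf : Continuous f)
    (hfin : mdimSep (mDist X) f Set.univ < ⊤)
    (φ : X → ℝ) (hφ : Continuous φ)
    (μ : ProbabilityMeasure X) (hinv : Measure.map f (μ : Measure X) = (μ : Measure X))
    (U : Finset (Set X)) (hUopen : ∀ u ∈ U, IsOpen u) (hUcov : ∀ x : X, ∃ u ∈ U, x ∈ u)
    (δ : ℝ) (hδ : 0 < δ) :
    ∃ (j : ℕ) (lam : Fin j → ℝ) (νi : Fin j → ProbabilityMeasure X),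
      0 < j ∧ (∀ i, 0 < lam i) ∧ (∑ i, lam i) = 1 ∧
      (∀ i, Ergodic f (νi i : Measure X)) ∧
      ((⨅ (ξ : FinBorelPartition X) (_ : ∀ s ∈ ξ.parts, ∃ u ∈ U, s ⊆ u),
          ((dynEntropy f (μ : Measure X) ξ : ℝ) : EReal))
        ≤ (⨅ (ξ : FinBorelPartition X) (_ : ∀ s ∈ ξ.parts, ∃ u ∈ U, s ⊆ u),
            ((dynEntropy f (∑ i, ENNReal.ofReal (lam i) • (νi i : Measure X)) ξ : ℝ) : EReal))
          + ((δ / 2 : ℝ) : EReal)) ∧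
      |(∫ x, φ x ∂(∑ i, ENNReal.ofReal (lam i) • (νi i : Measure X))) -
        ∫ x, φ x ∂(μ : Measure X)| < δ := by
  let V : U → Set X := fun u => u
  have hV : ∀ u, IsOpen (V u) := fun u => hUopen u u.2
  have hne : (adaptedLabels V).Nonempty :=
    adaptedLabels_nonempty (fun u => (hV u).measurableSet) fun x =>
      let ⟨u, hu, hx⟩ := hUcov x
      ⟨⟨u, hu⟩, hx⟩
  obtain ⟨j, w, τ, hw, hw1, hτ, hint, hrate⟩ :=
    exists_ergodic_combination_approx hf hV hne hφ hinv (half_pos hδ)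
  refine ⟨j, w, τ, ?_, hw, hw1, hτ, ?_, ?_⟩
  · rcases j.eq_zero_or_pos with rfl | hj
    · simp at hw1
    · exact hj
  · set ν := ∑ i, ENNReal.ofReal (w i) • (τ i : Measure X) with hν
    have hνP : IsProbabilityMeasure ν := ⟨by
      simp [hν, ← ENNReal.ofReal_sum_of_nonneg fun i _ => (hw i).le, hw1]⟩
    have hνf : MeasurePreserving f ν ν := by
      refine ⟨hf.measurable, Measure.ext fun s hs => ?_⟩
      rw [Measure.map_apply hf.measurable hs]
      simp [hν, fun i => (hτ i).measure_preimage hs.nullMeasurableSet]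
    have hreal : ∀ s, MeasurableSet s → ν.real s = ∑ i, w i * (τ i : Measure X).real s := by
      intro s _
      simp [hν, measureReal_def, ENNReal.toReal_sum, ENNReal.mul_ne_top, (hw _).le]
    have hmix := le_coverRate_of_mix hf.measurable hne (fun i => (hw i).le) hw1 hreal
    obtain ⟨c, hc, hcμ⟩ := exists_labelRate_lt hne
      (hrate.trans_le (add_le_add_left hmix (δ / 2)))
    obtain ⟨ξ, hξ, hξc⟩ := exists_partition_dynEntropy_le ⟨hf.measurable, hinv⟩ hc
    have h1 : dynEntropy f (μ : Measure X) ξ ≤ coverRate f V ν + δ / 2 := hξc.trans hcμ.le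
    have h2 : (coverRate f V ν : EReal) ≤ ⨅ (η : FinBorelPartition X)
        (_ : ∀ s ∈ η.parts, ∃ u ∈ U, s ⊆ u), ((dynEntropy f ν η : ℝ) : EReal) :=
      le_iInf₂ fun η hη => EReal.coe_le_coe_iff.2 (coverRate_le_dynEntropy hνf hη)
    refine (iInf₂_le ξ hξ).trans ((EReal.coe_le_coe_iff.2 h1).trans ?_)
    rw [EReal.coe_add]
    gcongr
  · rw [integral_finsetSum_measure fun i _ =>
      (integrable_of_continuous hφ _).smul_measure ENNReal.ofReal_ne_top]
    simp only [integral_smul_measure, ENNReal.toReal_ofReal (hw _).le, smul_eq_mul]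
    exact hint.trans (half_lt_self hδ)
end

section
/- Let (X,d) be a compact metric space and f: X → X continuous. Fix ε > 0, β > 0, N, m ∈ ℕ and n_1, …, n_N ∈ ℕ, and for each 1 ≤ i ≤ N let E_i ⊂ X be an (n_i, 5ε/4)-separated set. Set a_1 = 0, a_{i+1} = a_i + n_i + m for 1 ≤ i < N, and c = a_N + n_N. Suppose (x_1,…,x_N), (x'_1,…,x'_N) ∈ E_1 × ⋯ × E_N are distinct tuples and y, y' ∈ X satisfy d_{n_i}(f^{a_i}(y), x_i) < β and d_{n_i}(f^{a_i}(y'), x'_i) < β for every i. Then d_c(y,y') > 5ε/4 − 2β. In particular, if β ≤ ε/8 then d_c(y,y') > ε, so distinct tuples of shadowed points produce distinct, (c,ε)-separated shadowing points. -/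
open Filter Set MeasureTheory
open scoped ENNReal NNReal Topology

theorem exists_lt_of_lt_dynDist {Y : Type*} {d : Y → Y → ℝ} {f : Y → Y} {n : ℕ} {r : ℝ} {x y : Y}
    (hr : 0 ≤ r) (h : r < dynDist d f n x y) : ∃ j < n, r < d (f^[j] x) (f^[j] y) := by
  rcases Nat.eq_zero_or_pos n with rfl | hn
  · simp only [dynDist, Real.iSup_of_isEmpty] at h
    exact absurd h hr.not_gt
  · have : Nonempty (Fin n) := ⟨⟨0, hn⟩⟩
    obtain ⟨j, hj⟩ := exists_lt_of_lt_ciSup h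
    exact ⟨j, j.isLt, hj⟩

theorem le_dynDist {Y : Type*} (d : Y → Y → ℝ) (f : Y → Y) {n j : ℕ} (hj : j < n) (x y : Y) :
    d (f^[j] x) (f^[j] y) ≤ dynDist d f n x y :=
  le_ciSup (f := fun j : Fin n => d (f^[(j : ℕ)] x) (f^[(j : ℕ)] y))
    (Set.finite_range _).bddAbove ⟨j, hj⟩

/-- The end times `a i + n i` of consecutive disjoint orbit segments are nondecreasing. -/
theorem add_length_le_of_succ {N m : ℕ} {a n : Fin N → ℕ}
    (hastep : ∀ (i : ℕ) (h : i + 1 < N),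
      a ⟨i + 1, h⟩ = a ⟨i, Nat.lt_of_succ_lt h⟩ + n ⟨i, Nat.lt_of_succ_lt h⟩ + m)
    {i j : ℕ} (hij : i ≤ j) (hj : j < N) :
    a ⟨i, hij.trans_lt hj⟩ + n ⟨i, hij.trans_lt hj⟩ ≤ a ⟨j, hj⟩ + n ⟨j, hj⟩ := by
  induction j, hij using Nat.le_induction with
  | base => exact le_rfl
  | succ k _ ih =>
    have h₁ := ih (Nat.lt_of_succ_lt hj)
    have h₂ := hastep k hj
    omega

/-- Separation of shadowing points: if `y, y'` `β`-shadow (in the dynamical metrics) two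
distinct tuples of points taken from `(n_i, 5ε/4)`-separated sets, placed with gaps `m`,
then `y` and `y'` are `(c, 5ε/4 − 2β)`-separated; in particular `(c,ε)`-separated when
`β ≤ ε/8`. -/
theorem shadowing_points_separated
    {X : Type*} [MetricSpace X] [CompactSpace X]
    (f : X → X) (hf : Continuous f) (ε β : ℝ) (hε : 0 < ε) (hβ : 0 < β)
    (N m : ℕ) (hN : 0 < N) (n : Fin N → ℕ) (E : Fin N → Set X)
    (hE : ∀ i, IsDynSep (mDist X) f (n i) (5 * ε / 4) (E i))
    (a : Fin N → ℕ) (ha0 : a ⟨0, hN⟩ = 0)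
    (hastep : ∀ (i : ℕ) (h : i + 1 < N),
      a ⟨i + 1, h⟩ = a ⟨i, Nat.lt_of_succ_lt h⟩ + n ⟨i, Nat.lt_of_succ_lt h⟩ + m)
    (c : ℕ)
    (hc : c = a ⟨N - 1, Nat.sub_lt hN Nat.one_pos⟩ + n ⟨N - 1, Nat.sub_lt hN Nat.one_pos⟩)
    (x x' : Fin N → X) (hx : ∀ i, x i ∈ E i) (hx' : ∀ i, x' i ∈ E i) (hxx' : x ≠ x')
    (y y' : X)
    (hy : ∀ i, dynDist (mDist X) f (n i) (f^[a i] y) (x i) < β)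
    (hy' : ∀ i, dynDist (mDist X) f (n i) (f^[a i] y') (x' i) < β) :
    5 * ε / 4 - 2 * β < dynDist (mDist X) f c y y' ∧
    (β ≤ ε / 8 → ε < dynDist (mDist X) f c y y') := by
  have key : 5 * ε / 4 - 2 * β < dynDist (mDist X) f c y y' := by
    obtain ⟨i, hi⟩ := Function.ne_iff.mp hxx'
    obtain ⟨j, hj, hsep⟩ :=
      exists_lt_of_lt_dynDist (by positivity) (hE i (hx i) (hx' i) hi)
    have hend : a i + n i ≤ c :=
      hc ▸ add_length_le_of_succ hastep (Nat.le_sub_one_of_lt i.isLt) _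
    have hclose := (le_dynDist (mDist X) f hj (f^[a i] y) (x i)).trans_lt (hy i)
    have hclose' := (le_dynDist (mDist X) f hj (f^[a i] y') (x' i)).trans_lt (hy' i)
    have hle := le_dynDist (mDist X) f (show j + a i < c by omega) y y'
    simp only [mDist, Function.iterate_add_apply] at hsep hclose hclose' hle ⊢
    rw [dist_comm] at hclose
    have htri := dist_triangle4 (f^[j] (x i)) (f^[j] (f^[a i] y)) (f^[j] (f^[a i] y'))
      (f^[j] (x' i))
    linarith
  exact ⟨key, fun hβε => by linarith⟩
end

section
/- Fix 1 ≤ p < ∞ and a sequence ν = (ν_n)_{n∈ℕ} of positive reals with Σ_{n=1}^∞ ν_n < ∞. Let σ be the backward shift on ℓ^p(ν) and K = {x ∈ ℓ^p(ν) : |x_n| ≤ 1 for all n}, which is a compact σ-invariant subset. Then the upper metric mean dimension of the shift restricted to K with respect to the norm metric equals 1: mdim_M(K, σ, ‖·‖_{ℓ^p(ν)}) = 1. -/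
open Filter Set MeasureTheory
open scoped ENNReal NNReal Topology

noncomputable section

/-- The `ℓ^p(ν)` distance between two real sequences. -/
def lpwDist (p : ℝ) (ν : ℕ → ℝ) (x y : ℕ → ℝ) : ℝ :=
  (∑' n : ℕ, |x n - y n| ^ p * ν n) ^ (1 / p)

/-- The backward shift on real sequences. -/
def shiftSeq (x : ℕ → ℝ) : ℕ → ℝ := fun n => x (n + 1)

/-- The set `K = {x : |x_n| ≤ 1 for all n}`. -/
def Kball : Set (ℕ → ℝ) := {x : ℕ → ℝ | ∀ n, |x n| ≤ 1}

end

lemma shiftSeq_iterate_apply (j : ℕ) (x : ℕ → ℝ) (i : ℕ) : shiftSeq^[j] x i = x (i + j) := by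
  induction j generalizing i with
  | zero => rfl
  | succ j ih =>
    rw [Function.iterate_succ_apply', shiftSeq, ih]
    congr 1
    omega

lemma shiftSeq_iterate_mem_Kball {x : ℕ → ℝ} (hx : x ∈ Kball) (j : ℕ) :
    shiftSeq^[j] x ∈ Kball := fun i => by
  rw [shiftSeq_iterate_apply]
  exact hx _

lemma abs_sub_le_two_of_mem_Kball {x y : ℕ → ℝ} (hx : x ∈ Kball) (hy : y ∈ Kball) (n : ℕ) :
    |x n - y n| ≤ 2 := by
  have h1 := abs_le.1 (hx n)
  have h2 := abs_le.1 (hy n)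
  exact abs_le.2 ⟨by linarith, by linarith⟩

lemma summable_lpw_of_mem_Kball {p : ℝ} (hp : 1 ≤ p) {ν : ℕ → ℝ} (hν : ∀ n, 0 < ν n)
    (hsum : Summable ν) {x y : ℕ → ℝ} (hx : x ∈ Kball) (hy : y ∈ Kball) :
    Summable fun n => |x n - y n| ^ p * ν n :=
  Summable.of_nonneg_of_le (fun n => mul_nonneg (by positivity) (hν n).le)
    (fun n => mul_le_mul_of_nonneg_right
      (Real.rpow_le_rpow (abs_nonneg _) (abs_sub_le_two_of_mem_Kball hx hy n) (by linarith))
      (hν n).le) (hsum.mul_left (2 ^ p))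

lemma abs_sub_mul_le_lpwDist {p : ℝ} (hp : 1 ≤ p) {ν : ℕ → ℝ} (hν : ∀ n, 0 < ν n)
    (hsum : Summable ν) {x y : ℕ → ℝ} (hx : x ∈ Kball) (hy : y ∈ Kball) (n : ℕ) :
    |x n - y n| * ν n ^ (1 / p) ≤ lpwDist p ν x y := by
  have hp0 : 0 < p := by linarith
  have h := (summable_lpw_of_mem_Kball hp hν hsum hx hy).le_tsum n
    (fun m _ => mul_nonneg (by positivity) (hν m).le)
  have h2 := Real.rpow_le_rpow (mul_nonneg (by positivity) (hν n).le) h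
    (show 0 ≤ 1 / p by positivity)
  rwa [Real.mul_rpow (by positivity) (hν n).le, ← Real.rpow_mul (abs_nonneg _),
    mul_one_div_cancel hp0.ne', Real.rpow_one] at h2

/-- Closeness of finitely many coordinates controls the `ℓ^p(ν)` distance on `K`. -/
lemma exists_coords_lpwDist_le {p : ℝ} (hp : 1 ≤ p) {ν : ℕ → ℝ} (hν : ∀ n, 0 < ν n)
    (hsum : Summable ν) {ε δ : ℝ} (hε : 0 < ε) (hδ : 0 < δ)
    (h : δ ^ p * ∑' n, ν n ≤ ε ^ p / 2) :
    ∃ L : ℕ, ∀ x ∈ Kball, ∀ y ∈ Kball, (∀ i < L, |x i - y i| ≤ δ) →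
      lpwDist p ν x y ≤ ε := by
  have hp0 : 0 < p := by linarith
  have ht : Tendsto (fun L => 2 ^ p * ∑' k, ν (k + L)) atTop (𝓝 (2 ^ p * 0)) :=
    (tendsto_sum_nat_add ν).const_mul _
  rw [mul_zero] at ht
  obtain ⟨L, hL⟩ := (ht.eventually_le_const
    (show 0 < ε ^ p / 2 by positivity)).exists
  refine ⟨L, fun x hx y hy hxy => ?_⟩
  have hs := summable_lpw_of_mem_Kball hp hν hsum hx hy
  have hhead : ∑ i ∈ Finset.range L, |x i - y i| ^ p * ν i ≤ δ ^ p * ∑' n, ν n := by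
    calc _ ≤ ∑ i ∈ Finset.range L, δ ^ p * ν i :=
          Finset.sum_le_sum fun i hi => mul_le_mul_of_nonneg_right
            (Real.rpow_le_rpow (abs_nonneg _) (hxy i (Finset.mem_range.1 hi)) hp0.le) (hν i).le
      _ = δ ^ p * ∑ i ∈ Finset.range L, ν i := by rw [Finset.mul_sum]
      _ ≤ _ := mul_le_mul_of_nonneg_left
            (hsum.sum_le_tsum _ fun i _ => (hν i).le) (by positivity)
  have htail : ∑' k, |x (k + L) - y (k + L)| ^ p * ν (k + L) ≤ 2 ^ p * ∑' k, ν (k + L) := by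
    rw [← tsum_mul_left]
    exact Summable.tsum_le_tsum (fun k => mul_le_mul_of_nonneg_right
      (Real.rpow_le_rpow (abs_nonneg _) (abs_sub_le_two_of_mem_Kball hx hy _) hp0.le) (hν _).le)
      ((summable_nat_add_iff L).2 hs) (((summable_nat_add_iff L).2 hsum).mul_left _)
  have htot : ∑' n, |x n - y n| ^ p * ν n ≤ ε ^ p := by
    rw [← hs.sum_add_tsum_nat_add L]
    linarith
  calc lpwDist p ν x y ≤ (ε ^ p) ^ (1 / p) :=
        Real.rpow_le_rpow (tsum_nonneg fun n => mul_nonneg (by positivity) (hν n).le) htot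
          (by positivity)
    _ = ε := by rw [← Real.rpow_mul hε.le, mul_one_div_cancel hp0.ne', Real.rpow_one]

lemma abs_sub_le_of_floor_eq {a b δ : ℝ} (hδ : 0 < δ) (ha : |a| ≤ 1) (hb : |b| ≤ 1)
    (h : ⌊(a + 1) / δ⌋₊ = ⌊(b + 1) / δ⌋₊) : |a - b| ≤ δ := by
  have ha' := abs_le.1 ha
  have hb' := abs_le.1 hb
  have h1 := Nat.floor_le (show 0 ≤ (a + 1) / δ from div_nonneg (by linarith) hδ.le)
  have h2 := Nat.lt_floor_add_one ((a + 1) / δ)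
  have h3 := Nat.floor_le (show 0 ≤ (b + 1) / δ from div_nonneg (by linarith) hδ.le)
  have h4 := Nat.lt_floor_add_one ((b + 1) / δ)
  rw [h] at h1 h2
  have h5 : (a + 1) / δ - (b + 1) / δ = (a - b) / δ := by ring
  have h6 : |(a - b) / δ| ≤ 1 := by
    rw [← h5]
    exact abs_le.2 ⟨by linarith, by linarith⟩
  rwa [abs_div, abs_of_pos hδ, div_le_one hδ] at h6

lemma card_le_of_isDynSep {p : ℝ} {ν : ℕ → ℝ} {ε δ : ℝ} (hε : 0 < ε) (hδ : 0 < δ) {L : ℕ}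
    (hL : ∀ x ∈ Kball, ∀ y ∈ Kball, (∀ i < L, |x i - y i| ≤ δ) → lpwDist p ν x y ≤ ε)
    (n : ℕ) {E : Finset (ℕ → ℝ)} (hE : ↑E ⊆ Kball)
    (hsep : IsDynSep (lpwDist p ν) shiftSeq n ε ↑E) :
    E.card ≤ (⌊2 / δ⌋₊ + 1) ^ (n + L) := by
  have hcell : ∀ x ∈ Kball, ∀ i, ⌊(x i + 1) / δ⌋₊ < ⌊2 / δ⌋₊ + 1 := fun x hx i =>
    Nat.lt_succ_of_le (Nat.floor_mono (div_le_div_of_nonneg_right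
      (by linarith [(abs_le.1 (hx i)).2]) hδ.le))
  let code : (ℕ → ℝ) → Fin (n + L) → Fin (⌊2 / δ⌋₊ + 1) :=
    fun x i => Fin.ofNat _ ⌊(x i + 1) / δ⌋₊
  have hinj : Set.InjOn code ↑E := by
    intro x hx y hy hxy
    by_contra hne
    refine absurd (hsep hx hy hne) (not_lt.2 (Real.iSup_le (fun j => ?_) hε.le))
    refine hL _ (shiftSeq_iterate_mem_Kball (hE hx) _) _
      (shiftSeq_iterate_mem_Kball (hE hy) _) fun i hi => ?_
    rw [shiftSeq_iterate_apply, shiftSeq_iterate_apply]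
    refine abs_sub_le_of_floor_eq hδ (hE hx _) (hE hy _) ?_
    have h := congrArg Fin.val (congrFun hxy ⟨i + j, by omega⟩)
    simpa [code, Fin.ofNat, Nat.mod_eq_of_lt (hcell x (hE hx) _),
      Nat.mod_eq_of_lt (hcell y (hE hy) _)] using h
  have h := Finset.card_le_card_of_injOn (t := Finset.univ) code
    (fun _ _ => Finset.mem_coe.2 (Finset.mem_univ _)) hinj
  simpa using h

lemma hSep_le {p : ℝ} {ν : ℕ → ℝ} {ε δ : ℝ} (hε : 0 < ε) (hδ : 0 < δ) {L : ℕ}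
    (hL : ∀ x ∈ Kball, ∀ y ∈ Kball, (∀ i < L, |x i - y i| ≤ δ) → lpwDist p ν x y ≤ ε) :
    hSep (lpwDist p ν) shiftSeq Kball ε ≤ (Real.log (2 / δ + 1) : ℝ) := by
  have hfl : ((⌊2 / δ⌋₊ + 1 : ℕ) : ℝ) ≤ 2 / δ + 1 := by
    push_cast
    linarith [Nat.floor_le (show 0 ≤ 2 / δ by positivity)]
  have hlog : 0 ≤ Real.log (2 / δ + 1) :=
    Real.log_nonneg (by linarith [show 0 < 2 / δ by positivity])
  have hlim : Tendsto (fun n : ℕ => (1 + (L : ℝ) / n) * Real.log (2 / δ + 1)) atTop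
      (𝓝 (Real.log (2 / δ + 1))) := by
    simpa using ((tendsto_const_div_atTop_nhds_zero_nat (L : ℝ)).const_add 1).mul_const
      (Real.log (2 / δ + 1))
  rw [← ((continuous_coe_real_ereal.tendsto _).comp hlim).limsup_eq]
  refine limsup_le_limsup ?_
  filter_upwards [eventually_gt_atTop 0] with n hn
  have hn' : (0 : ℝ) < n := Nat.cast_pos.2 hn
  refine EReal.coe_le_coe_iff.2 ?_
  rw [div_le_iff₀ hn']
  have hcard : sepMaxCard (lpwDist p ν) shiftSeq n ε Kball ≤ (⌊2 / δ⌋₊ + 1) ^ (n + L) := by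
    refine csSup_le' ?_
    rintro m ⟨E, hE, hsep, rfl⟩
    exact card_le_of_isDynSep hε hδ hL n hE hsep
  have hle : (sepMaxCard (lpwDist p ν) shiftSeq n ε Kball : ℝ) ≤ (2 / δ + 1) ^ (n + L) :=
    calc _ ≤ ((⌊2 / δ⌋₊ + 1 : ℕ) : ℝ) ^ (n + L) := by exact_mod_cast hcard
      _ ≤ _ := pow_le_pow_left₀ (Nat.cast_nonneg _) hfl _
  have heq : (1 + (L : ℝ) / n) * Real.log (2 / δ + 1) * n
      = Real.log ((2 / δ + 1) ^ (n + L)) := by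
    rw [Real.log_pow]
    push_cast
    field_simp
  rw [heq]
  rcases Nat.eq_zero_or_pos (sepMaxCard (lpwDist p ν) shiftSeq n ε Kball) with h0 | h0
  · rw [h0, Real.log_pow]
    simp only [Nat.cast_zero, Real.log_zero]
    positivity
  · exact Real.log_le_log (Nat.cast_pos.2 h0) hle

/-- The sequences whose first `n` entries lie on the grid `δℤ` and which vanish afterwards. -/
def gridSeq (δ : ℝ) {n m : ℕ} (c : Fin n → Fin m) : ℕ → ℝ :=
  fun i => if h : i < n then (c ⟨i, h⟩ : ℕ) * δ else 0

lemma gridSeq_apply (δ : ℝ) {n m : ℕ} (c : Fin n → Fin m) (i : Fin n) :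
    gridSeq δ c i = (c i : ℕ) * δ := by
  simp [gridSeq]

lemma gridSeq_mem_Kball {δ : ℝ} (hδ : 0 < δ) {n : ℕ} (c : Fin n → Fin (⌊1 / δ⌋₊ + 1)) :
    gridSeq δ c ∈ Kball := by
  intro i
  rw [gridSeq]
  split_ifs with h
  · rw [abs_of_nonneg (by positivity), ← le_div_iff₀ hδ]
    exact (Nat.cast_le.2 (Nat.le_of_lt_succ (c ⟨i, h⟩).2)).trans (Nat.floor_le (by positivity))
  · simp

lemma le_abs_gridSeq_sub {δ : ℝ} (hδ : 0 < δ) {n m : ℕ} {c c' : Fin n → Fin m} {i : Fin n}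
    (h : c i ≠ c' i) : δ ≤ |gridSeq δ c i - gridSeq δ c' i| := by
  rw [gridSeq_apply, gridSeq_apply, ← sub_mul, abs_mul, abs_of_pos hδ]
  refine le_mul_of_one_le_left hδ.le ?_
  have hne : ((c i : ℕ) : ℤ) - ((c' i : ℕ) : ℤ) ≠ 0 := by
    have := Fin.val_ne_of_ne h
    omega
  exact_mod_cast Int.one_le_abs hne

lemma pow_le_sepMaxCard {p : ℝ} (hp : 1 ≤ p) {ν : ℕ → ℝ} (hν : ∀ n, 0 < ν n)
    (hsum : Summable ν) {ε δ : ℝ} (hδ : 0 < δ) (h : ε < δ * ν 0 ^ (1 / p)) {n : ℕ}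
    (hbdd : BddAbove {m | ∃ E : Finset (ℕ → ℝ), ↑E ⊆ Kball ∧
      IsDynSep (lpwDist p ν) shiftSeq n ε ↑E ∧ E.card = m}) :
    (⌊1 / δ⌋₊ + 1) ^ n ≤ sepMaxCard (lpwDist p ν) shiftSeq n ε Kball := by
  classical
  have hinj : Function.Injective
      (gridSeq δ : (Fin n → Fin (⌊1 / δ⌋₊ + 1)) → ℕ → ℝ) := by
    intro c c' heq
    by_contra hne
    obtain ⟨i, hi⟩ := Function.ne_iff.1 hne
    have := le_abs_gridSeq_sub hδ hi
    rw [heq, sub_self, abs_zero] at this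
    linarith
  refine le_csSup hbdd ⟨Finset.univ.image
    (gridSeq δ : (Fin n → Fin (⌊1 / δ⌋₊ + 1)) → ℕ → ℝ), ?_, ?_, ?_⟩
  · intro x hx
    obtain ⟨c, -, rfl⟩ := Finset.mem_image.1 (Finset.mem_coe.1 hx)
    exact gridSeq_mem_Kball hδ c
  · intro x hx y hy hxy
    obtain ⟨c, -, rfl⟩ := Finset.mem_image.1 (Finset.mem_coe.1 hx)
    obtain ⟨c', -, rfl⟩ := Finset.mem_image.1 (Finset.mem_coe.1 hy)
    obtain ⟨i, hi⟩ := Function.ne_iff.1 (fun hc : c = c' => hxy (by rw [hc]))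
    have hd := abs_sub_mul_le_lpwDist hp hν hsum
      (shiftSeq_iterate_mem_Kball (gridSeq_mem_Kball hδ c) i)
      (shiftSeq_iterate_mem_Kball (gridSeq_mem_Kball hδ c') i) 0
    rw [shiftSeq_iterate_apply, shiftSeq_iterate_apply, zero_add] at hd
    calc ε < δ * ν 0 ^ (1 / p) := h
      _ ≤ |gridSeq δ c i - gridSeq δ c' i| * ν 0 ^ (1 / p) :=
        mul_le_mul_of_nonneg_right (le_abs_gridSeq_sub hδ hi) (Real.rpow_nonneg (hν 0).le _)
      _ ≤ _ := hd
      _ ≤ dynDist (lpwDist p ν) shiftSeq n (gridSeq δ c) (gridSeq δ c') :=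
        le_ciSup (f := fun j : Fin n => lpwDist p ν (shiftSeq^[(j : ℕ)] (gridSeq δ c))
          (shiftSeq^[(j : ℕ)] (gridSeq δ c'))) (Set.finite_range _).bddAbove i
  · rw [Finset.card_image_of_injective _ hinj]
    simp

lemma le_hSep {p : ℝ} (hp : 1 ≤ p) {ν : ℕ → ℝ} (hν : ∀ n, 0 < ν n)
    (hsum : Summable ν) {ε δ : ℝ} (hδ : 0 < δ) (h : ε < δ * ν 0 ^ (1 / p))
    (hbdd : ∀ n, BddAbove {m | ∃ E : Finset (ℕ → ℝ), ↑E ⊆ Kball ∧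
      IsDynSep (lpwDist p ν) shiftSeq n ε ↑E ∧ E.card = m}) :
    ((Real.log (1 / δ) : ℝ) : EReal) ≤ hSep (lpwDist p ν) shiftSeq Kball ε := by
  rw [← limsup_const (f := (atTop : Filter ℕ)) ((Real.log (1 / δ) : ℝ) : EReal)]
  refine limsup_le_limsup ?_
  filter_upwards [eventually_gt_atTop 0] with n hn
  have hn' : (0 : ℝ) < n := Nat.cast_pos.2 hn
  refine EReal.coe_le_coe_iff.2 ?_
  rw [le_div_iff₀ hn', mul_comm, ← Real.log_pow]
  refine Real.log_le_log (by positivity) ?_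
  calc (1 / δ) ^ n ≤ ((⌊1 / δ⌋₊ + 1 : ℕ) : ℝ) ^ n := by
        refine pow_le_pow_left₀ (by positivity) ?_ _
        push_cast
        exact (Nat.lt_floor_add_one _).le
    _ ≤ _ := by exact_mod_cast pow_le_sepMaxCard hp hν hsum hδ h (hbdd n)

lemma tendsto_log_div_mul_abs_log_inv {c : ℝ} (hc : 0 < c) :
    Tendsto (fun ε : ℝ => Real.log (c / ε) * |Real.log ε|⁻¹) (𝓝[>] 0) (𝓝 1) := by
  have habs : Tendsto (fun ε : ℝ => |Real.log ε|) (𝓝[>] 0) atTop :=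
    tendsto_abs_atBot_atTop.comp Real.tendsto_log_nhdsGT_zero
  have hlim : Tendsto (fun ε : ℝ => Real.log c * |Real.log ε|⁻¹ + 1) (𝓝[>] 0) (𝓝 1) := by
    simpa using (habs.inv_tendsto_atTop.const_mul (Real.log c)).add_const 1
  refine hlim.congr' ?_
  filter_upwards [Ioo_mem_nhdsGT (zero_lt_one' ℝ)] with ε hε
  have hlog : Real.log ε < 0 := Real.log_neg hε.1 hε.2
  rw [Real.log_div hc.ne' hε.1.ne', abs_of_neg hlog]
  have := hlog.ne
  field_simp
  ring

/-- Lemma 4.1: the upper metric mean dimension of the backward shift restricted to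
`K = {x ∈ ℓ^p(ν) : |x_n| ≤ 1 ∀n}`, with respect to the `ℓ^p(ν)`-norm metric, equals `1`. -/
theorem mdim_shift_on_K_eq_one (p : ℝ) (hp : 1 ≤ p) (ν : ℕ → ℝ)
    (hν : ∀ n, 0 < ν n) (hsum : Summable ν) :
    mdimSep (lpwDist p ν) shiftSeq Kball = 1 := by
  have hp0 : 0 < p := by linarith
  have hS : 0 < ∑' n, ν n := hsum.tsum_pos (fun n => (hν n).le) 0 (hν 0)
  set a : ℝ := (1 / (2 * ∑' n, ν n)) ^ (1 / p) with ha_def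
  have ha : 0 < a := by positivity
  have hap : a ^ p * ∑' n, ν n = 1 / 2 := by
    rw [ha_def, ← Real.rpow_mul (by positivity), one_div_mul_cancel hp0.ne', Real.rpow_one]
    field_simp
  set b : ℝ := ν 0 ^ (1 / p) with hb_def
  have hb : 0 < b := Real.rpow_pos_of_pos (hν 0) _
  have hcover : ∀ ε : ℝ, 0 < ε → ∃ L : ℕ, ∀ x ∈ Kball, ∀ y ∈ Kball,
      (∀ i < L, |x i - y i| ≤ a * ε) → lpwDist p ν x y ≤ ε := fun ε hε => by
    refine exists_coords_lpwDist_le hp hν hsum hε (mul_pos ha hε) ?_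
    rw [Real.mul_rpow ha.le hε.le, mul_right_comm, hap]
    exact le_of_eq (by ring)
  have hupper : ∀ ε ∈ Ioo (0 : ℝ) 1,
      hSep (lpwDist p ν) shiftSeq Kball ε ≤ (Real.log ((2 / a + 1) / ε) : ℝ) := by
    rintro ε ⟨hε, hε1⟩
    obtain ⟨L, hL⟩ := hcover ε hε
    refine (hSep_le hε (mul_pos ha hε) hL).trans
      (EReal.coe_le_coe_iff.2 (Real.log_le_log (by positivity) ?_))
    rw [add_div, div_div]
    gcongr
    exact (one_le_div hε).2 hε1.le
  have hlower : ∀ ε : ℝ, 0 < ε →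
      ((Real.log (b / 2 / ε) : ℝ) : EReal) ≤ hSep (lpwDist p ν) shiftSeq Kball ε := by
    intro ε hε
    obtain ⟨L, hL⟩ := hcover ε hε
    have h := le_hSep (ε := ε) (δ := 2 * ε / b) hp hν hsum (by positivity)
      (by rw [← hb_def, div_mul_cancel₀ _ hb.ne']; linarith) (fun n => by
        refine ⟨(⌊2 / (a * ε)⌋₊ + 1) ^ (n + L), ?_⟩
        rintro m ⟨E, hE, hsep, rfl⟩
        exact card_le_of_isDynSep hε (mul_pos ha hε) hL n hE hsep)
    rwa [one_div_div, ← div_div] at h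
  have hlim : ∀ c : ℝ, 0 < c → Tendsto
      (fun ε : ℝ => ((Real.log (c / ε) : ℝ) : EReal) * (((|Real.log ε|)⁻¹ : ℝ) : EReal))
      (𝓝[>] 0) (𝓝 1) := fun c hc => by
    simpa only [← EReal.coe_mul, Function.comp_def, EReal.coe_one] using
      (continuous_coe_real_ereal.tendsto _).comp (tendsto_log_div_mul_abs_log_inv hc)
  have hnonneg : ∀ ε : ℝ, (0 : EReal) ≤ (((|Real.log ε|)⁻¹ : ℝ) : EReal) := fun ε =>
    EReal.coe_nonneg.2 (by positivity)
  refine Tendsto.limsup_eq (tendsto_of_tendsto_of_tendsto_of_le_of_le'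
    (hlim (b / 2) (by positivity)) (hlim (2 / a + 1) (by positivity)) ?_ ?_)
  · filter_upwards [self_mem_nhdsWithin] with ε hε
    exact mul_le_mul_of_nonneg_right (hlower ε hε) (hnonneg ε)
  · filter_upwards [Ioo_mem_nhdsGT (zero_lt_one' ℝ)] with ε hε
    exact mul_le_mul_of_nonneg_right (hupper ε hε) (hnonneg ε)
end
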